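/- arXiv:2404.07380 — 2 statements merged into one kernel-verified Lean document; each statement's English description precedes it below -/
import Mathlib

section
/- For every ε ∈ (0,1) there exists a constant C = C(ε) > 0 such that the following holds. Let q be a prime power, n ≥ 1, d ≥ 0, and {A_g}_{g∈𝔽_q^n} a collection of subsets of 𝔽_q^n with Σ_g |A_g| ≥ 2^{−d} q^{2n}. Let F = Σ_g 1_{A_g} ∘ 1_{A_g + g}, F' = Σ_g 1_{A_g} ∘ 1_{A_g}, and D : 𝔽_q^n → ℝ_{≥0} given by D(x) = |A_x|. Then either (1) |⟨μ_F, μ_D⟩ − 1| ≤ ε, or (2) there exists a subspace V ⊆ 𝔽_q^n of codimension at most C·(d+1)^8 such that ‖μ_{F'} ∗ μ_V‖_∞ ≥ 1 + ε/32. -/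
open scoped BigOperators Classical

noncomputable section

namespace SkewPaper

variable {G : Type*}

/-- Expectation (average) of `f` over a finite type: `E[f] = (1/|G|) ∑ x, f x`. -/
def expect [Fintype G] (f : G → ℝ) : ℝ := (∑ x, f x) / (Fintype.card G)

/-- Normalized inner product `⟨f, g⟩ = E_{x∈G} f(x) g(x)`. -/
def inprod [Fintype G] (f g : G → ℝ) : ℝ := expect (fun x => f x * g x)

/-- Convolution `(f ∗ g)(x) = E_{y∈G} f(y) g(x − y)`. -/
def conv [Fintype G] [AddCommGroup G] (f g : G → ℝ) : G → ℝ :=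
  fun x => expect (fun y => f y * g (x - y))

/-- Difference convolution `(f ∘ g)(x) = E_{y∈G} f(y) g(x + y)`. -/
def dconv [Fintype G] [AddCommGroup G] (f g : G → ℝ) : G → ℝ :=
  fun x => expect (fun y => f y * g (x + y))

/-- Indicator function `1_A` of a set `A`. -/
def ind (A : Set G) : G → ℝ := Set.indicator A (fun _ => (1 : ℝ))

/-- Normalized indicator `μ_A = (|G|/|A|) · 1_A`. -/
def muSet [Fintype G] (A : Set G) : G → ℝ :=
  fun x => ((Fintype.card G : ℝ) / (Nat.card A : ℝ)) * ind A x

/-- `μ_f = f / E[f]`, the normalization of `f` to have mean 1. -/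
def muFun [Fintype G] (f : G → ℝ) : G → ℝ := fun x => f x / expect f

/-- Weighted `L^p` norm `‖f‖_{p(ν)} = (E_x ν(x) |f(x)|^p)^{1/p}`. -/
def wnorm [Fintype G] (p : ℕ) (ν f : G → ℝ) : ℝ :=
  (expect (fun x => ν x * |f x| ^ p)) ^ ((p : ℝ)⁻¹)

/-- `L^p` norm with respect to the uniform measure. -/
def pnorm [Fintype G] (p : ℕ) (f : G → ℝ) : ℝ := wnorm p (fun _ => 1) f

/-- Sup norm `‖f‖_∞`. -/
def supNorm (f : G → ℝ) : ℝ := ⨆ x, |f x|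

/-- `A` is skew-corner-free: it contains no nontrivial skew corner
`(x,y), (x,y+h), (x+h,y')` with `h ≠ 0`. -/
def IsSkewCornerFree [AddCommGroup G] (A : Set (G × G)) : Prop :=
  ∀ x y y' h : G, (x, y) ∈ A → (x, y + h) ∈ A → (x + h, y') ∈ A → h = 0

/-- The set of quadruples `(x, y, y', h)` forming a skew corner of `A`. -/
def skewCorners [AddCommGroup G] (A : Set (G × G)) : Set (G × G × G × G) :=
  {q | (q.1, q.2.1) ∈ A ∧ (q.1, q.2.1 + q.2.2.2) ∈ A ∧ (q.1 + q.2.2.2, q.2.2.1) ∈ A}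

/-- The column `A_x = {y : (x,y) ∈ A}`. -/
def col (A : Set (G × G)) (x : G) : Set G := {y | (x, y) ∈ A}

/-- A Bohr set datum: a finite frequency set of characters together with a width. -/
structure BohrSet (G : Type*) [AddCommGroup G] where
  freq : Finset (AddChar G ℂ)
  width : ℝ

namespace BohrSet

variable [AddCommGroup G]

/-- The underlying set `Bohr(Γ, φ) = {x : |1 − γ(x)| ≤ φ for all γ ∈ Γ}`. -/
def toSet (B : BohrSet G) : Set G :=
  {x | ∀ γ ∈ B.freq, ‖(1 : ℂ) - γ x‖ ≤ B.width}

/-- The rank `|Γ|` of a Bohr set. -/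
def rank (B : BohrSet G) : ℕ := B.freq.card

/-- The dilate `B_ρ = Bohr(Γ, ρφ)`. -/
def dilate (B : BohrSet G) (ρ : ℝ) : BohrSet G := ⟨B.freq, ρ * B.width⟩

/-- `B'` is a sub-Bohr set of `B` (written `B' ≤ B`): its frequency set contains
that of `B` and its width is at most that of `B`. -/
def Sub (B' B : BohrSet G) : Prop := B.freq ⊆ B'.freq ∧ B'.width ≤ B.width

/-- A Bohr set of rank `r` is regular if for all `0 ≤ κ ≤ 1/(100r)`,
`|B_{1+κ}| ≤ (1+100κr)|B|` and `|B_{1−κ}| ≥ (1−100κr)|B|`. -/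
def IsRegular (B : BohrSet G) : Prop :=
  ∀ κ : ℝ, 0 ≤ κ → κ ≤ 1 / (100 * B.rank) →
    ((Nat.card (B.dilate (1 + κ)).toSet : ℝ) ≤ (1 + 100 * κ * B.rank) * (Nat.card B.toSet : ℝ) ∧
     (Nat.card (B.dilate (1 - κ)).toSet : ℝ) ≥ (1 - 100 * κ * B.rank) * (Nat.card B.toSet : ℝ))

/-- The density `μ(B) = |B|/|G|`. -/
def measure [Fintype G] (B : BohrSet G) : ℝ := (Nat.card B.toSet : ℝ) / (Fintype.card G : ℝ)

/-- The normalized indicator measure `μ_B`. -/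
def mu [Fintype G] (B : BohrSet G) : G → ℝ := muSet B.toSet

end BohrSet


/-- (r, λ)-simultaneously spread collection of subsets of 𝔽_q^n. -/
def SimSpread {F : Type*} [Field F] [Fintype F] {n : ℕ} {ι : Type*} [Fintype ι]
    (A : ι → Set (Fin n → F)) (r : ℕ) (lam : ℝ) : Prop :=
  ∀ V : Submodule F (Fin n → F), n ≤ Module.finrank F V + r →
    ∀ x : ι → Fin n → F,
      ∑ i, ((Nat.card ↥(((fun a => a - x i) '' A i) ∩ (V : Set (Fin n → F))) : ℝ) /
            (Nat.card (V : Set (Fin n → F)) : ℝ)) ^ 2 ≤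
        lam * ∑ i, ((Nat.card (A i) : ℝ) / ((Fintype.card F : ℝ) ^ n)) ^ 2

/-- (r, λ)-simultaneously spread in an ambient subspace `W`. -/
def SimSpreadIn {F : Type*} [Field F] [Fintype F] {n : ℕ} {ι : Type*} [Fintype ι]
    (W : Submodule F (Fin n → F)) (A : ι → Set (Fin n → F)) (r : ℕ) (lam : ℝ) : Prop :=
  ∀ V : Submodule F (Fin n → F), V ≤ W → Module.finrank F W ≤ Module.finrank F V + r →
    ∀ x : ι → Fin n → F, (∀ i, x i ∈ W) →
      ∑ i, ((Nat.card ↥(((fun a => a - x i) '' A i) ∩ (V : Set (Fin n → F))) : ℝ) /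
            (Nat.card (V : Set (Fin n → F)) : ℝ)) ^ 2 ≤
        lam * ∑ i, ((Nat.card (A i) : ℝ) / (Nat.card (W : Set (Fin n → F)) : ℝ)) ^ 2

/-- (r, δ, λ)-simultaneously spread collection of subsets of a regular Bohr set `B`. -/
def SimSpreadBohr {G : Type*} [AddCommGroup G] [Fintype G] {ι : Type*} [Fintype ι]
    (B : BohrSet G) (A : ι → Set G) (r : ℕ) (δ lam : ℝ) : Prop :=
  ∀ B' : BohrSet G, B'.Sub B → B'.IsRegular → B'.rank ≤ B.rank + r →
    δ * B.measure ≤ B'.measure →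
    ∀ x : ι → G,
      ∑ i, ((Nat.card ↥(((fun a => a - x i) '' A i) ∩ B'.toSet) : ℝ) /
            (Nat.card B'.toSet : ℝ)) ^ 2 ≤
        lam * ∑ i, ((Nat.card (A i) : ℝ) / (Nat.card B.toSet : ℝ)) ^ 2

/-- Expansion of a weighted moment of a sum of correlations over tuples of translates. -/
theorem card_mul_sum_corr_pow {G ι : Type*} [Fintype G] [AddCommGroup G] [Fintype ι]
    (b c : ι → G → ℝ) (h : G → ℝ) (k : ℕ) :
    (Fintype.card G : ℝ) * ∑ x, h x * (∑ g, ∑ y, b g y * c g (x + y)) ^ k =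
      ∑ j : Fin k → ι × G, ∑ t, ∑ s, h (s - t) *
        ((∏ i, b (j i).1 ((j i).2 + t)) * ∏ i, c (j i).1 ((j i).2 + s)) := by
  have key : ∀ t s : G, ∑ j : Fin k → ι × G,
      ((∏ i, b (j i).1 ((j i).2 + t)) * ∏ i, c (j i).1 ((j i).2 + s)) =
      (∑ g, ∑ y, b g y * c g ((s - t) + y)) ^ k := by
    intro t s
    have h1 : ∀ g, ∑ y, b g y * c g ((s - t) + y) = ∑ y, b g (y + t) * c g (y + s) := by
      intro g
      rw [← Equiv.sum_comp (Equiv.addRight t)]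
      refine Finset.sum_congr rfl fun y _ => ?_
      simp only [Equiv.coe_addRight]
      congr 2
      abel
    simp only [h1]
    rw [← Fintype.sum_prod_type' (f := fun g y => b g (y + t) * c g (y + s)), Fintype.sum_pow]
    simp only [Finset.prod_mul_distrib]
  rw [Finset.sum_comm]
  have h2 : ∀ t, ∑ j : Fin k → ι × G, ∑ s, h (s - t) *
        ((∏ i, b (j i).1 ((j i).2 + t)) * ∏ i, c (j i).1 ((j i).2 + s)) =
      ∑ x, h x * (∑ g, ∑ y, b g y * c g (x + y)) ^ k := by
    intro t
    rw [Finset.sum_comm, ← Equiv.sum_comp (Equiv.addRight t)]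
    refine Finset.sum_congr rfl fun s _ => ?_
    rw [← Finset.mul_sum, key, Equiv.coe_addRight, add_sub_cancel_right]
  simp only [h2, Finset.sum_const, Finset.card_univ, nsmul_eq_mul]

/-- Autocorrelation sums have nonnegative moments, which dominate the moments of the
corresponding sums of correlations with translates. -/
theorem sum_corr_translate_pow_le {G ι : Type*} [Fintype G] [AddCommGroup G] [Fintype ι]
    (b : ι → G → ℝ) (τ : ι → G) (k : ℕ) :
    ∑ x, (∑ g, ∑ y, b g y * b g (x + y - τ g)) ^ k ≤
      ∑ x, (∑ g, ∑ y, b g y * b g (x + y)) ^ k ∧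
    0 ≤ ∑ x, (∑ g, ∑ y, b g y * b g (x + y)) ^ k := by
  have hN : (0 : ℝ) < Fintype.card G := by exact_mod_cast Fintype.card_pos
  set B : (Fin k → ι × G) → ℝ := fun j => ∑ t, ∏ i, b (j i).1 ((j i).2 + t) with hB
  let σ : (Fin k → ι × G) ≃ (Fin k → ι × G) := Equiv.piCongrRight fun _ =>
    Equiv.prodShear (Equiv.refl ι) fun g => Equiv.subRight (τ g)
  have e1 : (Fintype.card G : ℝ) * ∑ x, (∑ g, ∑ y, b g y * b g (x + y)) ^ k =
      ∑ j, B j * B j := by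
    have := card_mul_sum_corr_pow b b (fun _ => 1) k
    simp only [one_mul] at this
    rw [this]
    refine Finset.sum_congr rfl fun j _ => ?_
    rw [hB, Finset.sum_mul_sum]
  have e2 : (Fintype.card G : ℝ) * ∑ x, (∑ g, ∑ y, b g y * b g (x + y - τ g)) ^ k =
      ∑ j, B j * B (σ j) := by
    have := card_mul_sum_corr_pow b (fun g y => b g (y - τ g)) (fun _ => 1) k
    simp only [one_mul] at this
    rw [this]
    refine Finset.sum_congr rfl fun j _ => ?_
    rw [hB, Finset.sum_mul_sum]
    refine Finset.sum_congr rfl fun t _ => Finset.sum_congr rfl fun s _ => ?_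
    congr 1
    refine Finset.prod_congr rfl fun i _ => ?_
    change b (j i).1 ((j i).2 + s - τ (j i).1) = b (j i).1 ((j i).2 - τ (j i).1 + s)
    congr 1
    abel
  have e3 : ∑ j, B (σ j) * B (σ j) = ∑ j, B j * B j :=
    Equiv.sum_comp σ fun j => B j * B j
  constructor
  · refine le_of_mul_le_mul_left ?_ hN
    rw [e1, e2]
    have : ∑ j, B j * B (σ j) ≤ ∑ j, (B j * B j + B (σ j) * B (σ j)) / 2 :=
      Finset.sum_le_sum fun j _ => by nlinarith [sq_nonneg (B j - B (σ j))]
    refine this.trans ?_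
    rw [← Finset.sum_div, Finset.sum_add_distrib, e3]
    linarith
  · refine le_of_mul_le_mul_left ?_ hN
    rw [e1, mul_zero]
    exact Finset.sum_nonneg fun j _ => mul_self_nonneg _

/-- If a bounded density correlates with `u`, then all even moments of `u` are large. -/
theorem card_mul_pow_le_of_correlation {G : Type*} [Fintype G] [Nonempty G] {w u : G → ℝ} {M ε : ℝ}
    (hε : 0 ≤ ε) (hw0 : ∀ x, 0 ≤ w x) (hwM : ∀ x, w x ≤ M) (hw : ∑ x, w x = Fintype.card G)
    (hc : ε * Fintype.card G ≤ |∑ x, w x * u x|) {j : ℕ} (hj : Even j) :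
    Fintype.card G * ε ^ j ≤ M * ∑ x, u x ^ j := by
  have hN : (0 : ℝ) < Fintype.card G := by exact_mod_cast Fintype.card_pos
  have h1 : ε ≤ ∑ x, w x / Fintype.card G * |u x| := by
    rw [← mul_le_mul_iff_left₀ hN, Finset.sum_mul]
    refine hc.trans ((Finset.abs_sum_le_sum_abs _ _).trans (le_of_eq ?_))
    refine Finset.sum_congr rfl fun x _ => ?_
    rw [abs_mul, abs_of_nonneg (hw0 x)]
    field_simp
  have h2 := Real.pow_arith_mean_le_arith_mean_pow Finset.univ
    (fun x => w x / Fintype.card G) (fun x => |u x|)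
    (fun x _ => div_nonneg (hw0 x) hN.le) (by rw [← Finset.sum_div, hw, div_self hN.ne'])
    (fun x _ => abs_nonneg _) j
  have h3 : ε ^ j ≤ ∑ x, w x / Fintype.card G * u x ^ j := by
    refine (pow_le_pow_left₀ hε h1 j).trans (h2.trans (le_of_eq ?_))
    simp only [hj.pow_abs]
  have h4 : ∑ x, w x / Fintype.card G * u x ^ j ≤ ∑ x, M / Fintype.card G * u x ^ j :=
    Finset.sum_le_sum fun x _ => by
      have := hj.pow_nonneg (u x)
      have := hwM x
      gcongr
  rw [← Finset.mul_sum] at h4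
  calc Fintype.card G * ε ^ j ≤ Fintype.card G * (M / Fintype.card G * ∑ x, u x ^ j) := by
        gcongr; exact h3.trans h4
    _ = _ := by field_simp

/-- Unbalancing: nonnegative moments with large even moments force large moments of `1 + v`. -/
theorem card_mul_one_add_pow_le {G : Type*} [Fintype G] {v : G → ℝ} {M ε : ℝ}
    (hε1 : ε ≤ 1) (hM : 0 ≤ M) (h0 : ∀ j : ℕ, 0 ≤ ∑ x, v x ^ j)
    (h1 : ∀ j : ℕ, Even j → Fintype.card G * ε ^ j ≤ M * ∑ x, v x ^ j) (K : ℕ) :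
    Fintype.card G * (1 + ε) ^ K ≤ 2 * M * ∑ x, (1 + v x) ^ K := by
  have e : ∑ x, (1 + v x) ^ K = ∑ j ∈ Finset.range (K + 1), (∑ x, v x ^ j) * K.choose j := by
    simp only [add_comm (1 : ℝ), add_pow, one_pow, mul_one, Finset.sum_mul]
    exact Finset.sum_comm
  have h2 : ∀ j : ℕ, Fintype.card G * (ε ^ j + (-ε) ^ j) ≤ 2 * M * ∑ x, v x ^ j := by
    intro j
    rcases j.even_or_odd with hj | hj
    · rw [hj.neg_pow]; linarith [h1 j hj]
    · rw [hj.neg_pow, add_neg_cancel, mul_zero]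
      exact mul_nonneg (by positivity) (h0 j)
  have h3 : (1 + ε) ^ K + (1 - ε) ^ K =
      ∑ j ∈ Finset.range (K + 1), (ε ^ j + (-ε) ^ j) * K.choose j := by
    simp only [add_mul, Finset.sum_add_distrib]
    congr 1
    · rw [add_comm, add_pow]; simp
    · rw [sub_eq_neg_add, add_pow]; simp
  have h4 : (0 : ℝ) ≤ (1 - ε) ^ K := pow_nonneg (by linarith) K
  calc (Fintype.card G : ℝ) * (1 + ε) ^ K
      ≤ Fintype.card G * ((1 + ε) ^ K + (1 - ε) ^ K) := by gcongr; linarith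
    _ = ∑ j ∈ Finset.range (K + 1), Fintype.card G * (ε ^ j + (-ε) ^ j) * K.choose j := by
        rw [h3, Finset.mul_sum]; simp only [mul_assoc]
    _ ≤ ∑ j ∈ Finset.range (K + 1), (2 * M * ∑ x, v x ^ j) * K.choose j := by
        exact Finset.sum_le_sum fun j _ =>
          mul_le_mul_of_nonneg_right (h2 j) (Nat.cast_nonneg _)
    _ = _ := by rw [e, Finset.mul_sum]; simp only [mul_assoc]

/-- Sifting: a large moment of an autocorrelation sum yields a dense set whose differences
mostly avoid the points where the autocorrelation sum is small. -/
theorem exists_dense_of_large_moment {G ι : Type*} [Fintype G] [AddCommGroup G] [Fintype ι]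
    (b : ι → G → ℝ) (hb : ∀ g y, b g y = 0 ∨ b g y = 1) (S : Finset G) (K : ℕ)
    {q M ε θ δ τ : ℝ} (hq : 0 < q) (hM : 0 < M) (hθ : 0 ≤ θ) (hδ : 0 < δ) (hτ : 0 < τ) (hε : 0 ≤ ε)
    (hlarge : Fintype.card G * (q * (1 + ε)) ^ K ≤
      2 * M * ∑ x, (∑ g, ∑ y, b g y * b g (x + y)) ^ K)
    (hsmall : ∀ x ∉ S, ∑ g, ∑ y, b g y * b g (x + y) ≤ q * θ)
    (hP : ∑ g, ∑ y, b g y ≤ M * q)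
    (hK : 4 * M * θ ^ K ≤ δ * (1 + ε) ^ K) (hτM : 4 * M * τ * M ^ K < 1) :
    ∃ B : Finset G, τ * Fintype.card G ≤ B.card ∧
      (1 - δ) * (B.card : ℝ) ^ 2 ≤ ∑ t ∈ B, ∑ s ∈ B, if s - t ∈ S then (1 : ℝ) else 0 := by
  have hN : (0 : ℝ) < Fintype.card G := by exact_mod_cast Fintype.card_pos
  have hb0 : ∀ g y, 0 ≤ b g y := fun g y => by rcases hb g y with h | h <;> simp [h]
  by_contra! hcon
  set h : G → ℝ := fun x => if x ∈ S then 0 else 1 with hh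
  set c : (Fin K → ι × G) → G → ℝ := fun j t => ∏ i, b (j i).1 ((j i).2 + t) with hc
  set B : (Fin K → ι × G) → Finset G := fun j =>
    Finset.univ.filter fun t => ∀ i, b (j i).1 ((j i).2 + t) = 1 with hB
  have hcB : ∀ j t, c j t = if t ∈ B j then 1 else 0 := by
    intro j t
    simp only [hc, hB, Finset.mem_filter, Finset.mem_univ, true_and]
    split_ifs with H
    · exact Finset.prod_eq_one fun i _ => H i
    · push Not at H
      obtain ⟨i, hi⟩ := H
      exact Finset.prod_eq_zero (Finset.mem_univ i) ((hb _ _).resolve_right hi)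
  have hcard : ∀ j, ∑ t, c j t = (B j).card := by
    intro j; simp [hcB]
  set bad : (Fin K → ι × G) → ℝ := fun j => ∑ t, ∑ s, h (s - t) * (c j t * c j s) with hbad
  have hbad0 : ∀ j, 0 ≤ bad j := fun j => Finset.sum_nonneg fun t _ => Finset.sum_nonneg fun s _ => by
    rw [hcB, hcB, hh]; dsimp only; split_ifs <;> simp
  have hbadB : ∀ j, bad j + ∑ t ∈ B j, ∑ s ∈ B j, (if s - t ∈ S then (1 : ℝ) else 0) =
      ((B j).card : ℝ) ^ 2 := by
    intro j
    have : bad j = ∑ t ∈ B j, ∑ s ∈ B j, h (s - t) := by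
      simp only [hbad, hcB]
      rw [← Finset.sum_filter_add_sum_filter_not Finset.univ (· ∈ B j)]
      rw [Finset.sum_eq_zero (s := Finset.univ.filter (¬ · ∈ B j)), add_zero, Finset.filter_univ_mem]
      · refine Finset.sum_congr rfl fun t ht => ?_
        simp [ht]
      · intro t ht
        simp only [Finset.mem_filter, Finset.mem_univ, true_and] at ht
        simp [ht]
    rw [this, ← Finset.sum_add_distrib]
    simp only [← Finset.sum_add_distrib]
    rw [Finset.sum_congr rfl (g := fun _ => ((B j).card : ℝ))]
    · simp [sq]
    · intro t _
      rw [Finset.sum_congr rfl (g := fun _ => (1 : ℝ))]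
      · simp
      · intro s _
        simp only [hh]; split_ifs <;> simp
  have hj : ∀ j, ((B j).card : ℝ) ^ 2 ≤ τ * Fintype.card G * (B j).card + bad j / δ := by
    intro j
    by_cases hs : τ * Fintype.card G ≤ (B j).card
    · have h1 := hcon (B j) hs
      have h2 := hbadB j
      have h3 : ((B j).card : ℝ) ^ 2 ≤ bad j / δ := by
        rw [le_div_iff₀ hδ]; linarith
      have h4 : 0 ≤ τ * Fintype.card G * (B j).card := by positivity
      linarith
    · push Not at hs
      have h4 : 0 ≤ bad j / δ := div_nonneg (hbad0 j) hδ.le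
      have h5 : (0 : ℝ) ≤ (B j).card := by positivity
      nlinarith
  have hsum := Finset.sum_le_sum fun j (_ : j ∈ Finset.univ) => hj j
  rw [Finset.sum_add_distrib, ← Finset.mul_sum, ← Finset.sum_div] at hsum
  have e1 : ∑ j, ((B j).card : ℝ) ^ 2 =
      Fintype.card G * ∑ x, (∑ g, ∑ y, b g y * b g (x + y)) ^ K := by
    have := card_mul_sum_corr_pow b b (fun _ => 1) K
    simp only [one_mul] at this
    rw [this]
    refine Finset.sum_congr rfl fun j _ => ?_
    rw [← hcard, sq, Finset.sum_mul_sum]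
  have e2 : ∑ j, ((B j).card : ℝ) = Fintype.card G * (∑ g, ∑ y, b g y) ^ K := by
    simp only [← hcard, hc]
    rw [Finset.sum_comm]
    have : ∀ t, ∑ j : Fin K → ι × G, ∏ i, b (j i).1 ((j i).2 + t) = (∑ g, ∑ y, b g y) ^ K := by
      intro t
      rw [← Fintype.sum_pow (fun p : ι × G => b p.1 (p.2 + t)),
        Fintype.sum_prod_type]
      congr 1
      exact Finset.sum_congr rfl fun g _ => Equiv.sum_comp (Equiv.addRight t) (b g)
    simp [this]
  have e3 : ∑ j, bad j ≤ Fintype.card G * (Fintype.card G * (q * θ) ^ K) := by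
    rw [hbad, ← card_mul_sum_corr_pow b b h K]
    gcongr
    have : ∀ x, h x * (∑ g, ∑ y, b g y * b g (x + y)) ^ K ≤ (q * θ) ^ K := by
      intro x
      simp only [hh]
      split_ifs with H
      · rw [zero_mul]; positivity
      · rw [one_mul]
        exact pow_le_pow_left₀ (Finset.sum_nonneg fun g _ => Finset.sum_nonneg fun y _ =>
          mul_nonneg (hb0 _ _) (hb0 _ _)) (hsmall x H) K
    refine (Finset.sum_le_sum fun x _ => this x).trans (by simp)
  set W := ∑ x, (∑ g, ∑ y, b g y * b g (x + y)) ^ K with hW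
  rw [e1, e2] at hsum
  have hPK : (∑ g, ∑ y, b g y) ^ K ≤ (M * q) ^ K :=
    pow_le_pow_left₀ (Finset.sum_nonneg fun g _ => Finset.sum_nonneg fun y _ => hb0 _ _) hP K
  have h6 : W ≤ Fintype.card G * (τ * (M * q) ^ K + (q * θ) ^ K / δ) := by
    refine le_of_mul_le_mul_left (hsum.trans ?_) hN
    calc _ ≤ τ * Fintype.card G * (Fintype.card G * (M * q) ^ K) +
          Fintype.card G * (Fintype.card G * (q * θ) ^ K) / δ := by gcongr
      _ = _ := by ring
  have h7 : (q * (1 + ε)) ^ K ≤ 2 * M * (τ * (M * q) ^ K + (q * θ) ^ K / δ) := by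
    refine le_of_mul_le_mul_left (hlarge.trans ?_) hN
    calc _ ≤ 2 * M * (Fintype.card G * (τ * (M * q) ^ K + (q * θ) ^ K / δ)) := by gcongr
      _ = _ := by ring
  have h8 : q ^ K * (1 + ε) ^ K ≤ q ^ K * (2 * M * τ * M ^ K + 2 * M * θ ^ K / δ) := by
    calc _ = (q * (1 + ε)) ^ K := (mul_pow _ _ _).symm
      _ ≤ _ := h7
      _ = _ := by rw [mul_pow, mul_pow]; ring
  have h9 := le_of_mul_le_mul_left h8 (by positivity)
  have h10 : 2 * M * θ ^ K / δ ≤ (1 + ε) ^ K / 2 := by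
    rw [div_le_iff₀ hδ]; linarith
  have h11 : (1 : ℝ) ≤ (1 + ε) ^ K := one_le_pow₀ (by linarith)
  linarith

theorem sum_balanced_corr {G : Type*} [Fintype G] [AddCommGroup G] (f : G → ℝ) (t : G) :
    ∑ y, (f y - (∑ z, f z) / Fintype.card G) * (f (y + t) - (∑ z, f z) / Fintype.card G) =
      ∑ y, f y * f (y + t) - (∑ z, f z) ^ 2 / Fintype.card G := by
  have hN : (0 : ℝ) < Fintype.card G := by exact_mod_cast Fintype.card_pos
  have e : ∑ y, f (y + t) = ∑ z, f z := Equiv.sum_comp (Equiv.addRight t) f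
  simp only [sub_mul, mul_sub, Finset.sum_sub_distrib, ← Finset.sum_mul, ← Finset.mul_sum, e,
    Finset.sum_const, Finset.card_univ, nsmul_eq_mul]
  field_simp
  ring

/-- A density correlating with translated autocorrelations forces a dense set most of whose
differences are popular. -/
theorem exists_dense_of_correlation {G ι : Type*} [Fintype G] [AddCommGroup G] [Fintype ι]
    (b : ι → G → ℝ) (hb : ∀ g y, b g y = 0 ∨ b g y = 1) (σ : ι → G) (w : G → ℝ) (D K : ℕ)
    {q ε δ : ℝ} (hq : 0 < q) (hqb : q = ∑ g, (∑ y, b g y) ^ 2 / Fintype.card G)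
    (hε0 : 0 ≤ ε) (hε1 : ε ≤ 1) (hδ : 0 < δ) (hw0 : ∀ x, 0 ≤ w x) (hwM : ∀ x, w x ≤ 2 ^ D)
    (hw : ∑ x, w x = Fintype.card G)
    (hc : ε * Fintype.card G ≤
      |∑ x, w x * ((∑ g, ∑ y, b g y * b g (x + y - σ g)) / q - 1)|)
    (hP : ∑ g, ∑ y, b g y ≤ 2 ^ D * q)
    (hK : 4 * 2 ^ D * (1 + ε / 8) ^ K ≤ δ * (1 + ε) ^ K) :
    ∃ B : Finset G, (Fintype.card G : ℝ) ≤ 2 ^ (D * (K + 1) + 3) * B.card ∧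
      (1 - δ) * (B.card : ℝ) ^ 2 ≤ ∑ t ∈ B, ∑ s ∈ B,
        if s - t ∈ ({x | q * (1 + ε / 8) ≤ ∑ g, ∑ y, b g y * b g (x + y)} : Finset G)
          then (1 : ℝ) else 0 := by
  set β : ι → G → ℝ := fun g y => b g y - (∑ z, b g z) / Fintype.card G with hβ
  have hbal : ∀ x (s : ι → G), ∑ g, ∑ y, β g y * β g (x + y - s g) =
      ∑ g, ∑ y, b g y * b g (x + y - s g) - q := by
    intro x s
    rw [hqb, ← Finset.sum_sub_distrib]
    refine Finset.sum_congr rfl fun g _ => ?_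
    have := sum_balanced_corr (b g) (x - s g)
    simp only [hβ]
    convert this using 4 <;> abel_nf
  have hbal0 : ∀ x, ∑ g, ∑ y, β g y * β g (x + y) = ∑ g, ∑ y, b g y * b g (x + y) - q := by
    intro x
    simpa using hbal x 0
  set u : G → ℝ := fun x => (∑ g, ∑ y, b g y * b g (x + y - σ g)) / q - 1 with hu
  set v : G → ℝ := fun x => (∑ g, ∑ y, b g y * b g (x + y)) / q - 1 with hv
  have hue : ∀ x, u x = (∑ g, ∑ y, β g y * β g (x + y - σ g)) / q := fun x => by
    rw [hbal, sub_div, div_self hq.ne']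
  have hve : ∀ x, v x = (∑ g, ∑ y, β g y * β g (x + y)) / q := fun x => by
    rw [hbal0, sub_div, div_self hq.ne']
  have hv0 : ∀ j, 0 ≤ ∑ x, v x ^ j := fun j => by
    simp only [hve, div_pow, ← Finset.sum_div]
    exact div_nonneg (sum_corr_translate_pow_le β σ j).2 (by positivity)
  have huv : ∀ j, ∑ x, u x ^ j ≤ ∑ x, v x ^ j := fun j => by
    simp only [hve, hue, div_pow, ← Finset.sum_div]
    have := (sum_corr_translate_pow_le β σ j).1
    gcongr
  have hlarge := card_mul_one_add_pow_le hε1 (by positivity : (0 : ℝ) ≤ 2 ^ D) hv0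
    (fun j hj => (card_mul_pow_le_of_correlation hε0 hw0 hwM hw hc hj).trans
      (mul_le_mul_of_nonneg_left (huv j) (by positivity))) K
  have hM : 4 * (2 : ℝ) ^ D * (2 ^ (D * (K + 1) + 3))⁻¹ * (2 ^ D) ^ K < 1 := by
    rw [← pow_mul, pow_add, mul_add, mul_one, pow_add]
    field_simp
    norm_num
  obtain ⟨B, hB1, hB2⟩ := exists_dense_of_large_moment b hb
    ({x | q * (1 + ε / 8) ≤ ∑ g, ∑ y, b g y * b g (x + y)} : Finset G) K hq
    (by positivity : (0 : ℝ) < 2 ^ D) (by positivity : 0 ≤ 1 + ε / 8) hδ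
    (by positivity : (0 : ℝ) < (2 ^ (D * (K + 1) + 3))⁻¹) hε0 (by
      have e : ∀ x, ∑ g, ∑ y, b g y * b g (x + y) = q * (1 + v x) := fun x => by
        simp only [hv]; field_simp; ring
      simp only [e, mul_pow, ← Finset.mul_sum]
      have := mul_le_mul_of_nonneg_left hlarge (by positivity : 0 ≤ q ^ K)
      linarith)
    (fun x hx => by simpa using (le_of_lt (by simpa using hx))) hP hK hM
  refine ⟨B, ?_, hB2⟩
  rwa [inv_mul_le_iff₀ (by positivity)] at hB1

/-- Exponential moment bound for sums of independent bounded centred variables. -/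
theorem sum_exp_le {Ω κ : Type*} [Fintype κ] [DecidableEq κ] (A : Finset Ω) (X : κ → Ω → ℝ)
    (hX : ∀ i, ∀ ω ∈ A, |X i ω| ≤ 1) (hX0 : ∀ i, ∑ ω ∈ A, X i ω = 0) {l : ℝ} (hl : |l| ≤ 1) :
    ∑ ω ∈ Fintype.piFinset (fun _ : κ => A), Real.exp (l * ∑ i, X i (ω i)) ≤
      (A.card : ℝ) ^ Fintype.card κ * Real.exp (l ^ 2 * Fintype.card κ) := by
  have h1 : ∀ i, ∑ ω ∈ A, Real.exp (l * X i ω) ≤ A.card * Real.exp (l ^ 2) := by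
    intro i
    have h2 : ∀ ω ∈ A, Real.exp (l * X i ω) ≤ 1 + l * X i ω + l ^ 2 := by
      intro ω hω
      have h3 : |l * X i ω| ≤ 1 := by
        rw [abs_mul]; exact mul_le_one₀ hl (abs_nonneg _) (hX i ω hω)
      have h4 := (abs_le.1 (Real.abs_exp_sub_one_sub_id_le h3)).2
      have h5 : (l * X i ω) ^ 2 ≤ l ^ 2 := by
        rw [mul_pow]
        exact mul_le_of_le_one_right (sq_nonneg _) ((sq_le_one_iff_abs_le_one _).2 (hX i ω hω))
      linarith
    calc _ ≤ ∑ ω ∈ A, (1 + l * X i ω + l ^ 2) := Finset.sum_le_sum h2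
      _ = A.card * (1 + l ^ 2) := by
        simp only [Finset.sum_add_distrib, ← Finset.mul_sum, hX0, Finset.sum_const]
        simp; ring
      _ ≤ _ := by gcongr; rw [add_comm]; exact Real.add_one_le_exp _
  calc _ = ∏ i : κ, ∑ ω ∈ A, Real.exp (l * X i ω) := by
        rw [Finset.prod_univ_sum]
        refine Finset.sum_congr rfl fun ω _ => ?_
        rw [Finset.mul_sum, Real.exp_sum]
    _ ≤ ∏ _i : κ, (A.card * Real.exp (l ^ 2)) :=
        Finset.prod_le_prod (fun i _ => Finset.sum_nonneg fun ω _ => (Real.exp_pos _).le)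
          fun i _ => h1 i
    _ = _ := by
        rw [Finset.prod_const, mul_pow, Finset.card_univ, ← Real.exp_nat_mul, mul_comm (l ^ 2)]

/-- Hoeffding-type tail bound, in counting form. -/
theorem card_abs_sum_gt_le {Ω : Type*} (A : Finset Ω) (X : Ω → ℝ)
    (hX : ∀ ω ∈ A, |X ω| ≤ 1) (hX0 : ∑ ω ∈ A, X ω = 0) (m : ℕ) {η : ℝ} (hη0 : 0 ≤ η) (hη : η ≤ 1) :
    (((Fintype.piFinset (fun _ : Fin m => A)).filter
      fun ω => η * m < |∑ i, X (ω i)|).card : ℝ) ≤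
      2 * (A.card : ℝ) ^ m * Real.exp (-(η ^ 2 * m / 4)) := by
  have hl : |η / 2| ≤ 1 := by rw [abs_of_nonneg (by positivity)]; linarith
  have hl' : |-(η / 2)| ≤ 1 := by rwa [abs_neg]
  have h1 := sum_exp_le (κ := Fin m) A (fun _ => X) (fun _ => hX) (fun _ => hX0) hl
  have h2 := sum_exp_le (κ := Fin m) A (fun _ => X) (fun _ => hX) (fun _ => hX0) hl'
  rw [Fintype.card_fin] at h1 h2
  have h3 : (((Fintype.piFinset (fun _ : Fin m => A)).filter
      fun ω => η * m < |∑ i, X (ω i)|).card : ℝ) * Real.exp (η / 2 * (η * m)) ≤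
      2 * ((A.card : ℝ) ^ m * Real.exp ((η / 2) ^ 2 * m)) := by
    calc _ = ∑ ω ∈ (Fintype.piFinset (fun _ : Fin m => A)).filter
          (fun ω => η * m < |∑ i, X (ω i)|), Real.exp (η / 2 * (η * m)) := by simp
      _ ≤ ∑ ω ∈ (Fintype.piFinset (fun _ : Fin m => A)).filter
          (fun ω => η * m < |∑ i, X (ω i)|),
          (Real.exp (η / 2 * ∑ i, X (ω i)) + Real.exp (-(η / 2) * ∑ i, X (ω i))) := by
        refine Finset.sum_le_sum fun ω hω => ?_
        have h4 := (Finset.mem_filter.1 hω).2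
        rcases abs_cases (∑ i, X (ω i)) with ⟨h5, -⟩ | ⟨h5, -⟩
        · have : Real.exp (η / 2 * (η * m)) ≤ Real.exp (η / 2 * ∑ i, X (ω i)) := by
            rw [Real.exp_le_exp]; rw [h5] at h4; gcongr
          linarith [Real.exp_pos (-(η / 2) * ∑ i, X (ω i))]
        · have : Real.exp (η / 2 * (η * m)) ≤ Real.exp (-(η / 2) * ∑ i, X (ω i)) := by
            rw [Real.exp_le_exp, neg_mul_comm]; rw [h5] at h4; gcongr
          linarith [Real.exp_pos (η / 2 * ∑ i, X (ω i))]
      _ ≤ ∑ ω ∈ Fintype.piFinset (fun _ : Fin m => A),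
          (Real.exp (η / 2 * ∑ i, X (ω i)) + Real.exp (-(η / 2) * ∑ i, X (ω i))) :=
        Finset.sum_le_sum_of_subset_of_nonneg (Finset.filter_subset _ _)
          fun _ _ _ => by positivity
      _ ≤ _ := by
        rw [Finset.sum_add_distrib]
        rw [neg_sq] at h2
        linarith
  rw [← le_div_iff₀ (Real.exp_pos _), mul_div_assoc, mul_div_assoc, ← Real.exp_sub] at h3
  rw [mul_assoc]
  refine h3.trans (le_of_eq ?_)
  congr 3
  ring

/-- Croot–Sisask almost periodicity: the density `x ↦ |A ∩ (S + x)| / |A|` is almost invariant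
under many translations, when tested against bounded probability weights. -/
theorem exists_almost_periods {G : Type*} [Fintype G] [AddCommGroup G] (A S : Finset G)
    (hA : A.Nonempty) (m : ℕ) {η : ℝ} (hη0 : 0 < η) (hη : η ≤ 1)
    (hm : 4 * Fintype.card G * Real.exp (-(η ^ 2 * m / 4)) ≤ η * A.card)
    (g : G → ℝ) (hg : ∀ x, g x = (∑ s ∈ A, if s - x ∈ S then (1 : ℝ) else 0) / A.card) :
    ∃ T : Finset G, (A.card : ℝ) ^ m * Fintype.card G ≤ 2 * T.card * (Fintype.card G : ℝ) ^ m ∧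
      ∀ t ∈ T, ∀ w : G → ℝ, (∀ x, 0 ≤ w x) → (∀ x, w x ≤ 1 / A.card) → ∑ x, w x = 1 →
        |∑ x, w x * (g x - g (x - t))| ≤ 4 * η := by
  have hN : (0 : ℝ) < Fintype.card G := by exact_mod_cast Fintype.card_pos
  have hA0 : (0 : ℝ) < A.card := by exact_mod_cast hA.card_pos
  have hAN : (A.card : ℝ) ≤ Fintype.card G := by exact_mod_cast Finset.card_le_univ A
  have hm0 : (0 : ℝ) < m := by
    rcases Nat.eq_zero_or_pos m with h | h
    · subst h
      simp only [Nat.cast_zero, mul_zero, zero_div, neg_zero, Real.exp_zero, mul_one] at hm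
      nlinarith
    · exact_mod_cast h
  have hg01 : ∀ x, 0 ≤ g x ∧ g x ≤ 1 := by
    intro x
    rw [hg]
    constructor
    · exact div_nonneg (Finset.sum_nonneg fun s _ => by split_ifs <;> simp) hA0.le
    · rw [div_le_one hA0]
      calc _ ≤ ∑ s ∈ A, (1 : ℝ) := Finset.sum_le_sum fun s _ => by split_ifs <;> simp
        _ = _ := by simp
  set X : G → G → ℝ := fun x s => (if s - x ∈ S then (1 : ℝ) else 0) - g x with hX
  have hX1 : ∀ x, ∀ s ∈ A, |X x s| ≤ 1 := by
    intro x s _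
    have := hg01 x
    simp only [hX]
    rw [abs_le]
    split_ifs <;> constructor <;> linarith
  have hX0 : ∀ x, ∑ s ∈ A, X x s = 0 := by
    intro x
    simp only [hX, Finset.sum_sub_distrib, Finset.sum_const, nsmul_eq_mul]
    rw [hg]; field_simp; simp
  set P := Fintype.piFinset (fun _ : Fin m => A) with hP
  have hPcard : (P.card : ℝ) = (A.card : ℝ) ^ m := by simp [hP]
  set E : (Fin m → G) → Finset G := fun a =>
    Finset.univ.filter fun x => η * m < |∑ i, X x (a i)| with hE
  set L := P.filter fun a => ((E a).card : ℝ) ≤ η * A.card with hL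
  have hsumE : ∑ a ∈ P, ((E a).card : ℝ) ≤ η * A.card * (A.card : ℝ) ^ m / 2 := by
    calc ∑ a ∈ P, ((E a).card : ℝ)
        = ∑ x : G, ((P.filter fun a => η * m < |∑ i, X x (a i)|).card : ℝ) := by
          simp only [hE, Finset.card_filter, Nat.cast_sum]
          exact Finset.sum_comm
      _ ≤ ∑ x : G, 2 * (A.card : ℝ) ^ m * Real.exp (-(η ^ 2 * m / 4)) :=
          Finset.sum_le_sum fun x _ => card_abs_sum_gt_le A (X x) (hX1 x) (hX0 x) m hη0.le hη
      _ = (A.card : ℝ) ^ m / 2 * (4 * Fintype.card G * Real.exp (-(η ^ 2 * m / 4))) := by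
          simp; ring
      _ ≤ (A.card : ℝ) ^ m / 2 * (η * A.card) := by gcongr
      _ = _ := by ring
  have hLcard : (A.card : ℝ) ^ m ≤ 2 * L.card := by
    have h1 : ((P.filter fun a => ¬ ((E a).card : ℝ) ≤ η * A.card).card : ℝ) * (η * A.card) ≤
        η * A.card * (A.card : ℝ) ^ m / 2 := by
      refine le_trans ?_ hsumE
      calc _ = ∑ a ∈ P.filter (fun a => ¬ ((E a).card : ℝ) ≤ η * A.card), (η * A.card) := by
            simp
        _ ≤ ∑ a ∈ P.filter (fun a => ¬ ((E a).card : ℝ) ≤ η * A.card), ((E a).card : ℝ) :=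
            Finset.sum_le_sum fun a ha => (not_le.1 (Finset.mem_filter.1 ha).2).le
        _ ≤ _ := Finset.sum_le_sum_of_subset_of_nonneg (Finset.filter_subset _ _)
            fun _ _ _ => by positivity
    have h2 : (L.card : ℝ) + ((P.filter fun a => ¬ ((E a).card : ℝ) ≤ η * A.card).card : ℝ) =
        (A.card : ℝ) ^ m := by
      rw [← hPcard, hL]
      exact_mod_cast Finset.card_filter_add_card_filter_not _
    have h3 : ((P.filter fun a => ¬ ((E a).card : ℝ) ≤ η * A.card).card : ℝ) ≤
        (A.card : ℝ) ^ m / 2 := by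
      refine le_of_mul_le_mul_right ?_ (mul_pos hη0 hA0)
      linarith
    linarith
  obtain ⟨u, hu⟩ : ∃ u : Fin m → G, (L.card : ℝ) * Fintype.card G ≤
      ((Finset.univ.filter fun t : G => (fun i => u i + t) ∈ L).card : ℝ) *
        (Fintype.card G : ℝ) ^ m := by
    by_contra! hcon
    have h1 : ∑ u : Fin m → G,
        ((Finset.univ.filter fun t : G => (fun i => u i + t) ∈ L).card : ℝ) =
        Fintype.card G * L.card := by
      simp only [Finset.card_filter, Nat.cast_sum]
      rw [Finset.sum_comm]
      have : ∀ t : G, ∑ u : Fin m → G, (((if (fun i => u i + t) ∈ L then 1 else 0 : ℕ)) : ℝ) =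
          L.card := by
        intro t
        have := Equiv.sum_comp (Equiv.addRight (fun _ : Fin m => t))
          (fun u => ((if u ∈ L then 1 else 0 : ℕ) : ℝ))
        calc _ = ∑ u : Fin m → G, ((if u ∈ L then 1 else 0 : ℕ) : ℝ) := this
          _ = _ := by simp
      simp only [this, Finset.sum_const, Finset.card_univ, nsmul_eq_mul]
    have h2 := Finset.sum_lt_sum_of_nonempty (Finset.univ_nonempty (α := Fin m → G))
      fun u _ => hcon u
    rw [← Finset.sum_mul, h1] at h2
    simp only [Finset.sum_const, Finset.card_univ, Fintype.card_fun, Fintype.card_fin,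
      nsmul_eq_mul, Nat.cast_pow] at h2
    linarith
  have hTu : (A.card : ℝ) ^ m * Fintype.card G ≤
      2 * ((Finset.univ.filter fun t : G => (fun i => u i + t) ∈ L).card : ℝ) *
        (Fintype.card G : ℝ) ^ m := by nlinarith
  obtain ⟨t₀, ht₀⟩ : (Finset.univ.filter fun t : G => (fun i => u i + t) ∈ L).Nonempty := by
    by_contra! h
    rw [h] at hTu
    have : 0 < (A.card : ℝ) ^ m * Fintype.card G := by positivity
    simp at hTu
    linarith
  have ht₀L := (Finset.mem_filter.1 ht₀).2
  refine ⟨Finset.univ.filter fun t => (fun i => u i + t₀ + t) ∈ L, ?_, ?_⟩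
  · convert hTu using 4
    refine Finset.card_equiv (Equiv.addLeft t₀) fun t => ?_
    simp [add_assoc]
  · intro t ht w hw0 hw1 hw
    replace ht := (Finset.mem_filter.1 ht).2
    set E₁ := E fun i => u i + t₀ + t with hE₁
    set E₂ := (E fun i => u i + t₀).map (Equiv.addRight t).toEmbedding with hE₂
    have hc₁ : (E₁.card : ℝ) ≤ η * A.card := (Finset.mem_filter.1 ht).2
    have hc₂ : (E₂.card : ℝ) ≤ η * A.card := by
      rw [hE₂, Finset.card_map]; exact (Finset.mem_filter.1 ht₀L).2
    have hx : ∀ x, |g x - g (x - t)| ≤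
        2 * η + ((if x ∈ E₁ then 1 else 0) + if x ∈ E₂ then 1 else 0) := by
      intro x
      have hle : |g x - g (x - t)| ≤ 1 := by
        have := hg01 x
        have := hg01 (x - t)
        rw [abs_le]; constructor <;> linarith
      by_cases h1 : x ∈ E₁
      · rw [if_pos h1]; split_ifs <;> linarith
      by_cases h2 : x ∈ E₂
      · rw [if_pos h2]; split_ifs; linarith
      rw [if_neg h1, if_neg h2]
      have h3 : |∑ i, X x (u i + t₀ + t)| ≤ η * m := by
        by_contra! h
        exact h1 (Finset.mem_filter.2 ⟨Finset.mem_univ _, h⟩)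
      have h4 : |∑ i, X (x - t) (u i + t₀)| ≤ η * m := by
        by_contra! h
        refine h2 (Finset.mem_map.2 ⟨x - t, Finset.mem_filter.2 ⟨Finset.mem_univ _, h⟩, ?_⟩)
        simp
      have h5 : ∑ i, X (x - t) (u i + t₀) - ∑ i, X x (u i + t₀ + t) =
          m * (g x - g (x - t)) := by
        rw [← Finset.sum_sub_distrib]
        have : ∀ i, X (x - t) (u i + t₀) - X x (u i + t₀ + t) = g x - g (x - t) := by
          intro i
          simp only [hX]
          rw [show u i + t₀ - (x - t) = u i + t₀ + t - x by abel]
          ring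
        simp only [this, Finset.sum_const, Finset.card_univ, Fintype.card_fin, nsmul_eq_mul]
      have h6 : m * |g x - g (x - t)| ≤ m * (2 * η) := by
        rw [← abs_of_pos hm0, ← abs_mul, ← h5, abs_of_pos hm0]
        have := abs_sub (∑ i, X (x - t) (u i + t₀)) (∑ i, X x (u i + t₀ + t))
        linarith
      have := le_of_mul_le_mul_left h6 hm0
      linarith
    calc _ ≤ ∑ x, |w x * (g x - g (x - t))| := Finset.abs_sum_le_sum_abs _ _
      _ ≤ ∑ x, (w x * (2 * η) + ((if x ∈ E₁ then 1 / (A.card : ℝ) else 0) +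
          if x ∈ E₂ then 1 / (A.card : ℝ) else 0)) := by
        refine Finset.sum_le_sum fun x _ => ?_
        rw [abs_mul, abs_of_nonneg (hw0 x)]
        refine (mul_le_mul_of_nonneg_left (hx x) (hw0 x)).trans ?_
        have := hw0 x
        have := hw1 x
        rw [mul_add]
        split_ifs <;> linarith
      _ = 2 * η + (E₁.card / A.card + E₂.card / A.card) := by
        rw [Finset.sum_add_distrib, Finset.sum_add_distrib, ← Finset.sum_mul, hw]
        simp [div_eq_mul_inv]
      _ ≤ 2 * η + (η + η) := by
        gcongr
        · rwa [div_le_iff₀ hA0]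
        · rwa [div_le_iff₀ hA0]
      _ = _ := by ring

/-- Averaging of a function over the translates by a finite set. -/
def smooth {G : Type*} [AddCommGroup G] (T : Finset G) (w : G → ℝ) : G → ℝ :=
  fun x => (∑ t ∈ T, w (x + t)) / T.card

theorem norm_sum_smooth_mul_addChar {G : Type*} [Fintype G] [AddCommGroup G] (T : Finset G)
    (w : G → ℝ) (χ : AddChar G ℂ) :
    ‖∑ x, (smooth T w x : ℂ) * χ x‖ = ‖∑ t ∈ T, χ t‖ / T.card * ‖∑ x, (w x : ℂ) * χ x‖ := by
  have h1 : ∑ x, (smooth T w x : ℂ) * χ x =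
      (∑ t ∈ T, χ (-t)) / T.card * ∑ x, (w x : ℂ) * χ x := by
    calc ∑ x, (smooth T w x : ℂ) * χ x
        = ∑ x, ∑ t ∈ T, (w (x + t) : ℂ) * χ x / T.card := by
          refine Finset.sum_congr rfl fun x _ => ?_
          simp only [smooth]
          push_cast
          rw [Finset.sum_div, Finset.sum_mul]
          refine Finset.sum_congr rfl fun t _ => ?_
          ring
      _ = ∑ t ∈ T, ∑ x, (w (x + t) : ℂ) * χ x / T.card := Finset.sum_comm
      _ = ∑ t ∈ T, χ (-t) / T.card * ∑ x, (w x : ℂ) * χ x := by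
          refine Finset.sum_congr rfl fun t _ => ?_
          rw [← Equiv.sum_comp (Equiv.addRight t) fun x => (w x : ℂ) * χ x, Finset.mul_sum]
          refine Finset.sum_congr rfl fun x _ => ?_
          simp only [Equiv.coe_addRight]
          rw [show χ x = χ (-t) * χ (x + t) by rw [← AddChar.map_add_eq_mul]; congr 1; abel]
          ring
      _ = _ := by rw [← Finset.sum_mul, Finset.sum_div]
  rw [h1, norm_mul, norm_div]
  simp only [AddChar.map_neg_eq_conj, ← map_sum, RCLike.norm_conj, RCLike.norm_natCast]

theorem norm_sum_iterate_smooth_mul_addChar {G : Type*} [Fintype G] [AddCommGroup G]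
    (T : Finset G) (w : G → ℝ) (χ : AddChar G ℂ) (k : ℕ) :
    ‖∑ x, ((smooth T)^[k] w x : ℂ) * χ x‖ =
      (‖∑ t ∈ T, χ t‖ / T.card) ^ k * ‖∑ x, (w x : ℂ) * χ x‖ := by
  induction k with
  | zero => simp
  | succ k ih =>
    rw [Function.iterate_succ', Function.comp_apply, norm_sum_smooth_mul_addChar, ih, pow_succ']
    ring

/-- Parseval's identity for a complete family of characters. -/
theorem sum_norm_sq_addChar {G ι : Type*} [Fintype G] [AddCommGroup G] [Fintype ι]
    (χ : ι → AddChar G ℂ) (hχ : ∀ x, ∑ r, χ r x = if x = 0 then (Fintype.card G : ℂ) else 0)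
    (w : G → ℝ) : ∑ r, ‖∑ x, (w x : ℂ) * χ r x‖ ^ 2 = Fintype.card G * ∑ x, w x ^ 2 := by
  have h : ((∑ r, ‖∑ x, (w x : ℂ) * χ r x‖ ^ 2 : ℝ) : ℂ) =
      ((Fintype.card G * ∑ x, w x ^ 2 : ℝ) : ℂ) := by
    push_cast
    calc ∑ r, (‖∑ x, (w x : ℂ) * χ r x‖ : ℂ) ^ 2
        = ∑ r, ∑ x, ∑ y, (w x * w y : ℂ) * χ r (x - y) := by
          refine Finset.sum_congr rfl fun r _ => ?_
          rw [← Complex.mul_conj', map_sum, Finset.sum_mul_sum]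
          refine Finset.sum_congr rfl fun x _ => Finset.sum_congr rfl fun y _ => ?_
          rw [map_mul, Complex.conj_ofReal, ← AddChar.map_neg_eq_conj, sub_eq_add_neg,
            AddChar.map_add_eq_mul]
          ring
      _ = ∑ x, ∑ y, (w x * w y : ℂ) * ∑ r, χ r (x - y) := by
          rw [Finset.sum_comm]
          refine Finset.sum_congr rfl fun x _ => ?_
          rw [Finset.sum_comm]
          simp only [Finset.mul_sum]
      _ = _ := by
          simp only [hχ, sub_eq_zero, mul_ite, mul_zero, Finset.sum_ite_eq, Finset.mem_univ,
            if_true, Finset.mul_sum]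
          refine Finset.sum_congr rfl fun x _ => ?_
          ring
  exact_mod_cast h

/-- After repeated smoothing, correlations are nearly invariant under translations that are
annihilated by the large spectrum of the smoothing set. -/
theorem abs_sum_iterate_smooth_sub_le {G ι : Type*} [Fintype G] [AddCommGroup G] [Fintype ι]
    (χ : ι → AddChar G ℂ) (hχ : ∀ x, ∑ r, χ r x = if x = 0 then (Fintype.card G : ℂ) else 0)
    (T : Finset G) (w : G → ℝ) (k : ℕ) (v : G)
    (hv : ∀ r, 1 / 2 ≤ ‖∑ t ∈ T, χ r t‖ / T.card → χ r v = 1) (z : G) :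
    |∑ x, (smooth T)^[k] w x * (w (x + z) - w (x + (z + v)))| ≤ 2 * (1 / 2) ^ k * ∑ x, w x ^ 2 := by
  have hN : (0 : ℝ) < Fintype.card G := by exact_mod_cast Fintype.card_pos
  set W := (smooth T)^[k] w with hW
  have hinv : ∀ y, (Fintype.card G : ℂ) * w y = ∑ r, (∑ x, (w x : ℂ) * χ r x) * χ r (-y) := by
    intro y
    simp only [Finset.sum_mul]
    rw [Finset.sum_comm]
    simp only [mul_assoc, ← AddChar.map_add_eq_mul, ← Finset.mul_sum, hχ, ← sub_eq_add_neg,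
      sub_eq_zero, mul_ite, mul_zero, Finset.sum_ite_eq', Finset.mem_univ, if_true]
    ring
  have hmain : (Fintype.card G : ℂ) * ∑ x, (W x : ℂ) * (w (x + z) - w (x + (z + v))) =
      ∑ r, (∑ x, (w x : ℂ) * χ r x) * (∑ x, (W x : ℂ) * χ r (-x)) *
        (χ r (-z) * (1 - χ r (-v))) := by
    calc _ = ∑ x, (W x : ℂ) *
          (Fintype.card G * w (x + z) - Fintype.card G * w (x + (z + v))) := by
          rw [Finset.mul_sum]
          refine Finset.sum_congr rfl fun x _ => ?_
          ring
      _ = ∑ x, ∑ r, (∑ x, (w x : ℂ) * χ r x) * ((W x : ℂ) * χ r (-x)) *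
          (χ r (-z) * (1 - χ r (-v))) := by
          refine Finset.sum_congr rfl fun x _ => ?_
          rw [hinv, hinv, ← Finset.sum_sub_distrib, Finset.mul_sum]
          refine Finset.sum_congr rfl fun r _ => ?_
          rw [neg_add, neg_add, neg_add, AddChar.map_add_eq_mul, AddChar.map_add_eq_mul,
            AddChar.map_add_eq_mul]
          ring
      _ = _ := by
          rw [Finset.sum_comm]
          refine Finset.sum_congr rfl fun r _ => ?_
          rw [Finset.mul_sum, Finset.sum_mul]
  have hterm : ∀ r, ‖(∑ x, (w x : ℂ) * χ r x) * (∑ x, (W x : ℂ) * χ r (-x)) *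
        (χ r (-z) * (1 - χ r (-v)))‖ ≤ 2 * (1 / 2) ^ k * ‖∑ x, (w x : ℂ) * χ r x‖ ^ 2 := by
    intro r
    have hc : ‖∑ x, (W x : ℂ) * χ r (-x)‖ =
        (‖∑ t ∈ T, χ r t‖ / T.card) ^ k * ‖∑ x, (w x : ℂ) * χ r x‖ := by
      rw [← norm_sum_iterate_smooth_mul_addChar, ← hW, ← RCLike.norm_conj, map_sum]
      congr 1
      refine Finset.sum_congr rfl fun x _ => ?_
      rw [map_mul, AddChar.map_neg_eq_conj]
      simp
    rw [norm_mul, norm_mul, norm_mul, hc, AddChar.norm_apply]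
    by_cases h : 1 / 2 ≤ ‖∑ t ∈ T, χ r t‖ / T.card
    · rw [AddChar.map_neg_eq_conj, hv r h]
      simp
    · push Not at h
      have h1 : ‖1 - χ r (-v)‖ ≤ 2 := by
        refine (norm_sub_le _ _).trans ?_
        rw [AddChar.norm_apply, norm_one]; norm_num
      have h2 : (‖∑ t ∈ T, χ r t‖ / T.card) ^ k ≤ (1 / 2) ^ k :=
        pow_le_pow_left₀ (by positivity) h.le k
      calc _ ≤ ‖∑ x, (w x : ℂ) * χ r x‖ * ((1 / 2) ^ k * ‖∑ x, (w x : ℂ) * χ r x‖) *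
            (1 * 2) := by gcongr
        _ = _ := by ring
  refine le_of_mul_le_mul_left ?_ hN
  have h3 : (Fintype.card G : ℝ) * |∑ x, W x * (w (x + z) - w (x + (z + v)))| =
      ‖(Fintype.card G : ℂ) * ∑ x, (W x : ℂ) * (w (x + z) - w (x + (z + v)))‖ := by
    rw [norm_mul, RCLike.norm_natCast, ← Real.norm_eq_abs, ← Complex.norm_real]
    push_cast
    rfl
  rw [h3, hmain]
  refine (norm_sum_le _ _).trans ((Finset.sum_le_sum fun r _ => hterm r).trans (le_of_eq ?_))
  rw [← Finset.mul_sum, sum_norm_sq_addChar χ hχ]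
  ring

theorem card_mul_sum_comp_of_surjective {G H : Type*} [Fintype G] [AddCommGroup G] [Fintype H]
    [AddCommGroup H] (L : G →+ H) (hL : Function.Surjective L) (f : H → ℝ) :
    (Fintype.card H : ℝ) * ∑ x, f (L x) = Fintype.card G * ∑ y, f y := by
  have h1 : ∀ y, ∑ x, f (L x) = ∑ x, f (L x + y) := by
    intro y
    obtain ⟨x₀, rfl⟩ := hL y
    rw [← Equiv.sum_comp (Equiv.addRight x₀)]
    simp
  have h2 : ∀ y, ∑ x, f x = ∑ x, f (y + x) := fun y =>
    (Equiv.sum_comp (Equiv.addLeft y) f).symm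
  calc _ = ∑ y : H, ∑ x, f (L x) := by simp
    _ = ∑ y : H, ∑ x, f (L x + y) := Finset.sum_congr rfl fun y _ => h1 y
    _ = ∑ x, ∑ y : H, f (L x + y) := Finset.sum_comm
    _ = ∑ x : G, ∑ y, f y := Finset.sum_congr rfl fun x _ => (h2 _).symm
    _ = _ := by simp

/-- Chang's inequality: linearly independent frequencies in the large spectrum are few. -/
theorem exp_mul_card_le_of_linearIndependent {F κ : Type*} [Field F] [Fintype F] [Fintype κ]
    {n : ℕ} (ψ : AddChar F ℂ) (hψ : ψ ≠ 1) (r : κ → Fin n → F) (hr : LinearIndependent F r)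
    (T : Finset (Fin n → F)) (hT : ∀ i, 1 / 2 * (T.card : ℝ) ≤ ‖∑ t ∈ T, ψ (r i ⬝ᵥ t)‖) :
    Real.exp (Fintype.card κ / 16) * T.card ≤ Fintype.card (Fin n → F) := by
  have hsurj : Function.Surjective (Matrix.of r).mulVecLin := by
    rw [← LinearMap.range_eq_top]
    apply Submodule.eq_top_of_finrank_eq
    have h := LinearIndependent.rank_matrix (M := Matrix.of r) hr
    rw [Matrix.rank] at h
    rw [h, Module.finrank_pi]
  have hL : ∀ x i, (Matrix.of r).mulVecLin x i = r i ⬝ᵥ x := fun x i => rfl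
  choose c hc1 hc2 using fun i => Complex.exists_norm_eq_mul_self (∑ t ∈ T, ψ (r i ⬝ᵥ t))
  set X : κ → F → ℝ := fun i y => (c i * ψ y).re with hX
  have hX1 : ∀ i, ∀ y ∈ (Finset.univ : Finset F), |X i y| ≤ 1 := by
    intro i y _
    refine (Complex.abs_re_le_norm _).trans ?_
    rw [norm_mul, hc1, AddChar.norm_apply, one_mul]
  have hX0 : ∀ i, ∑ y ∈ (Finset.univ : Finset F), X i y = 0 := by
    intro i
    simp only [hX]
    rw [← Complex.re_sum, ← Finset.mul_sum, AddChar.sum_eq_zero_of_ne_one hψ]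
    simp
  have hXT : ∀ i, 1 / 2 * (T.card : ℝ) ≤ ∑ t ∈ T, X i (r i ⬝ᵥ t) := by
    intro i
    refine (hT i).trans (le_of_eq ?_)
    simp only [hX]
    rw [← Complex.re_sum, ← Finset.mul_sum, ← hc2, Complex.ofReal_re]
  set m : ℝ := (Fintype.card κ : ℝ) with hm
  have hup : ∑ x : Fin n → F, Real.exp (1 / 4 * ∑ i, X i (r i ⬝ᵥ x)) ≤
      Fintype.card (Fin n → F) * Real.exp (m / 16) := by
    have h1 := sum_exp_le Finset.univ X hX1 hX0 (l := 1 / 4) (by norm_num [abs_le])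
    rw [Fintype.piFinset_univ] at h1
    have h2 := card_mul_sum_comp_of_surjective (Matrix.of r).mulVecLin.toAddMonoidHom hsurj
      fun y => Real.exp (1 / 4 * ∑ i, X i (y i))
    have h3 : (0 : ℝ) < Fintype.card (κ → F) := by exact_mod_cast Fintype.card_pos
    refine le_of_mul_le_mul_left ?_ h3
    calc _ = (Fintype.card (Fin n → F) : ℝ) * ∑ y : κ → F, Real.exp (1 / 4 * ∑ i, X i (y i)) := h2
      _ ≤ Fintype.card (Fin n → F) *
          ((Fintype.card F : ℝ) ^ Fintype.card κ * Real.exp ((1 / 4) ^ 2 * m)) := by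
          gcongr; exact h1
      _ = _ := by
          rw [Fintype.card_fun (α := κ), show (1 / 4 : ℝ) ^ 2 * m = m / 16 by ring]
          push_cast; ring
  have hlow : Real.exp (m / 8) * T.card ≤ ∑ t ∈ T, Real.exp (1 / 4 * ∑ i, X i (r i ⬝ᵥ t)) := by
    have h1 : ∀ u : ℝ, Real.exp (m / 8) * (1 + (u - m / 8)) ≤ Real.exp u := by
      intro u
      calc _ ≤ Real.exp (m / 8) * Real.exp (u - m / 8) := by
            gcongr; rw [add_comm]; exact Real.add_one_le_exp _
        _ = _ := by rw [← Real.exp_add]; congr 1; ring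
    refine le_trans ?_ (Finset.sum_le_sum fun t _ => h1 _)
    rw [← Finset.mul_sum]
    gcongr
    rw [Finset.sum_add_distrib, Finset.sum_sub_distrib, ← Finset.mul_sum, Finset.sum_comm]
    have h2 : ∑ i : κ, 1 / 2 * (T.card : ℝ) ≤ ∑ i, ∑ t ∈ T, X i (r i ⬝ᵥ t) :=
      Finset.sum_le_sum fun i _ => hXT i
    simp only [Finset.sum_const, Finset.card_univ, nsmul_eq_mul, mul_one] at h2 ⊢
    rw [← hm] at h2
    linarith
  have hsub : ∑ t ∈ T, Real.exp (1 / 4 * ∑ i, X i (r i ⬝ᵥ t)) ≤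
      ∑ x : Fin n → F, Real.exp (1 / 4 * ∑ i, X i (r i ⬝ᵥ x)) :=
    Finset.sum_le_sum_of_subset_of_nonneg (Finset.subset_univ _) fun _ _ _ => (Real.exp_pos _).le
  refine le_of_mul_le_mul_left ?_ (Real.exp_pos (m / 16))
  calc _ = Real.exp (m / 8) * T.card := by
        rw [← mul_assoc, ← Real.exp_add]; congr 2; ring
    _ ≤ _ := hlow.trans (hsub.trans hup)
    _ = _ := by ring

/-- The annihilator of the large spectrum of a dense set contains a subspace of small
codimension. -/
theorem exists_submodule_annihilating_spectrum {F : Type*} [Field F] [Fintype F] {n : ℕ}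
    (ψ : AddChar F ℂ) (hψ : ψ ≠ 1) (T : Finset (Fin n → F)) (hT : T.Nonempty) :
    ∃ (V : Submodule F (Fin n → F)) (m : ℕ), n ≤ Module.finrank F V + m ∧
      Real.exp (m / 16) * T.card ≤ Fintype.card (Fin n → F) ∧
      ∀ r : Fin n → F, 1 / 2 ≤ ‖∑ t ∈ T, ψ (r ⬝ᵥ t)‖ / T.card → ∀ v ∈ V, ψ (r ⬝ᵥ v) = 1 := by
  have hT0 : (0 : ℝ) < T.card := by exact_mod_cast hT.card_pos
  obtain ⟨b, hbs, hspan, hlin⟩ := exists_linearIndependent F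
    {r : Fin n → F | 1 / 2 ≤ ‖∑ t ∈ T, ψ (r ⬝ᵥ t)‖ / T.card}
  set L := (Matrix.of (fun i : b => (i : Fin n → F))).mulVecLin with hL
  refine ⟨LinearMap.ker L, Fintype.card b, ?_, ?_, ?_⟩
  · have h1 := LinearMap.finrank_range_add_finrank_ker L
    have h2 := Submodule.finrank_le (LinearMap.range L)
    rw [Module.finrank_pi] at h1 h2
    rw [Fintype.card_fin] at h1
    omega
  · refine exp_mul_card_le_of_linearIndependent ψ hψ _ hlin T fun i => ?_
    have := hbs i.2
    rwa [Set.mem_ofPred_eq, le_div_iff₀ hT0] at this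
  · intro r hr v hv
    have h1 : r ∈ Submodule.span F b := by rw [hspan]; exact Submodule.subset_span hr
    have h2 : r ⬝ᵥ v = 0 := by
      clear hr
      induction h1 using Submodule.span_induction with
      | mem x hx => exact congrFun (LinearMap.mem_ker.1 hv) ⟨x, hx⟩
      | zero => exact zero_dotProduct v
      | add x y _ _ hx hy => rw [add_dotProduct, hx, hy, add_zero]
      | smul a x _ hx => rw [smul_dotProduct, hx, smul_zero]
    rw [h2, AddChar.map_zero_eq_one]

/-- Smoothing preserves bounded probability weights. -/
theorem iterate_smooth_weight {G : Type*} [Fintype G] [AddCommGroup G] {T : Finset G}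
    (hT : T.Nonempty) {w : G → ℝ} {c : ℝ} (h0 : ∀ x, 0 ≤ w x) (hc : ∀ x, w x ≤ c)
    (h1 : ∑ x, w x = 1) (k : ℕ) :
    (∀ x, 0 ≤ (smooth T)^[k] w x) ∧ (∀ x, (smooth T)^[k] w x ≤ c) ∧
      ∑ x, (smooth T)^[k] w x = 1 := by
  have hT0 : (0 : ℝ) < T.card := by exact_mod_cast hT.card_pos
  induction k with
  | zero => exact ⟨h0, hc, h1⟩
  | succ k ih =>
    obtain ⟨i0, ic, i1⟩ := ih
    simp only [Function.iterate_succ', Function.comp_apply]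
    set u := (smooth T)^[k] w
    refine ⟨fun x => div_nonneg (Finset.sum_nonneg fun t _ => i0 _) hT0.le, fun x => ?_, ?_⟩
    · rw [smooth, div_le_iff₀ hT0]
      refine (Finset.sum_le_sum fun t _ => ic (x + t)).trans (le_of_eq ?_)
      rw [Finset.sum_const, nsmul_eq_mul, mul_comm]
    · simp only [smooth]
      rw [← Finset.sum_div, Finset.sum_comm, div_eq_one_iff_eq hT0.ne']
      have : ∀ t, ∑ x, u (x + t) = 1 := fun t => (Equiv.sum_comp (Equiv.addRight t) u).trans i1
      simp [this]

/-- Repeated smoothing by almost periods changes the tested average only slightly. -/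
theorem abs_sum_sub_sum_iterate_smooth_le {G : Type*} [Fintype G] [AddCommGroup G] {T : Finset G}
    (hT : T.Nonempty) {w g : G → ℝ} {c β : ℝ} (h0 : ∀ x, 0 ≤ w x) (hc : ∀ x, w x ≤ c)
    (h1 : ∑ x, w x = 1)
    (hper : ∀ t ∈ T, ∀ w : G → ℝ, (∀ x, 0 ≤ w x) → (∀ x, w x ≤ c) → ∑ x, w x = 1 →
        |∑ x, w x * (g x - g (x - t))| ≤ β) (k : ℕ) :
    ∑ x, w x * g x - k * β ≤ ∑ x, (smooth T)^[k] w x * g x := by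
  have hT0 : (0 : ℝ) < T.card := by exact_mod_cast hT.card_pos
  induction k with
  | zero => simp
  | succ k ih =>
    obtain ⟨i0, ic, i1⟩ := iterate_smooth_weight hT h0 hc h1 k
    simp only [Function.iterate_succ', Function.comp_apply]
    set u := (smooth T)^[k] w
    have e : ∑ x, smooth T u x * g x = (∑ t ∈ T, ∑ x, u x * g (x - t)) / T.card := by
      simp only [smooth, div_mul_eq_mul_div]
      rw [← Finset.sum_div]
      simp only [Finset.sum_mul]
      rw [Finset.sum_comm]
      congr 1
      refine Finset.sum_congr rfl fun t _ => ?_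
      rw [← Equiv.sum_comp (Equiv.addRight t) fun x => u x * g (x - t)]
      simp
    have h2 : ∀ t ∈ T, ∑ x, u x * g x - β ≤ ∑ x, u x * g (x - t) := by
      intro t ht
      have := (abs_le.1 (hper t ht u i0 ic i1)).2
      simp only [mul_sub, Finset.sum_sub_distrib] at this
      linarith
    have h3 : ∑ x, u x * g x - β ≤ ∑ x, smooth T u x * g x := by
      rw [e, le_div_iff₀ hT0]
      refine le_trans (le_of_eq ?_) (Finset.sum_le_sum h2)
      rw [Finset.sum_const, nsmul_eq_mul, mul_comm]
    push_cast
    linarith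

/-- From almost periods to exact invariance: if most differences of `A` lie in `S`, then a
probability weight concentrates on `S` after any translation annihilated by the large spectrum of
a set of almost periods. -/
theorem exists_weight_of_almost_periods {G ι : Type*} [Fintype G] [AddCommGroup G] [Fintype ι]
    (χ : ι → AddChar G ℂ) (hχ : ∀ x, ∑ r, χ r x = if x = 0 then (Fintype.card G : ℂ) else 0)
    {A S T : Finset G} (hA : A.Nonempty) (hT : T.Nonempty) {δ β : ℝ}
    (hAS : (1 - δ) * (A.card : ℝ) ^ 2 ≤ ∑ t ∈ A, ∑ s ∈ A, if s - t ∈ S then (1 : ℝ) else 0)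
    (g : G → ℝ) (hg : ∀ x, g x = (∑ s ∈ A, if s - x ∈ S then (1 : ℝ) else 0) / A.card)
    (hper : ∀ t ∈ T, ∀ w : G → ℝ, (∀ x, 0 ≤ w x) → (∀ x, w x ≤ 1 / A.card) → ∑ x, w x = 1 →
        |∑ x, w x * (g x - g (x - t))| ≤ β) (k : ℕ) :
    ∃ ν : G → ℝ, (∀ z, 0 ≤ ν z) ∧ ∑ z, ν z = 1 ∧
      ∀ v, (∀ r, 1 / 2 ≤ ‖∑ t ∈ T, χ r t‖ / T.card → χ r v = 1) →
        1 - δ - k * β - 2 * (1 / 2) ^ k * (Fintype.card G / A.card) ≤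
          ∑ z, ν z * if z - v ∈ S then 1 else 0 := by
  have hA0 : (0 : ℝ) < A.card := by exact_mod_cast hA.card_pos
  set w : G → ℝ := fun x => if x ∈ A then 1 / (A.card : ℝ) else 0 with hw
  have w0 : ∀ x, 0 ≤ w x := fun x => by simp only [hw]; split_ifs <;> positivity
  have wc : ∀ x, w x ≤ 1 / A.card := fun x => by
    simp only [hw]; split_ifs
    · exact le_rfl
    · positivity
  have w1 : ∑ x, w x = 1 := by simp [hw, hA0.ne']
  have w2 : ∑ x, w x ^ 2 = 1 / A.card := by
    simp only [hw, ite_pow]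
    simp; field_simp
  obtain ⟨u0, -, u1⟩ := iterate_smooth_weight hT w0 wc w1 k
  have hper' := abs_sum_sub_sum_iterate_smooth_le hT w0 wc w1 hper k
  have htrans := fun v hv z => abs_sum_iterate_smooth_sub_le χ hχ T w k v hv z
  set u := (smooth T)^[k] w
  have hwg : 1 - δ ≤ ∑ x, w x * g x := by
    have : ∑ x, w x * g x = (∑ t ∈ A, ∑ s ∈ A, if s - t ∈ S then (1 : ℝ) else 0) /
        (A.card : ℝ) ^ 2 := by
      simp only [hw, ite_mul, zero_mul, Finset.sum_ite_mem, Finset.univ_inter]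
      rw [Finset.sum_div]
      refine Finset.sum_congr rfl fun t _ => ?_
      rw [hg]; field_simp
    rw [this, le_div_iff₀ (by positivity)]
    exact hAS
  have hgw : ∀ x, g x = ∑ z, w (x + z) * if z ∈ S then 1 else 0 := by
    intro x
    rw [hg, ← Equiv.sum_comp (Equiv.subRight x)]
    simp only [hw, Equiv.subRight_apply, add_sub_cancel, ite_mul, zero_mul, Finset.sum_ite_mem,
      Finset.univ_inter]
    rw [Finset.sum_div]
    refine Finset.sum_congr rfl fun t _ => ?_
    split_ifs <;> simp
  have hν : ∀ f : G → ℝ, ∑ z, (∑ x, u x * w (x + z)) * f z =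
      ∑ x, u x * ∑ z, w (x + z) * f z := by
    intro f
    simp only [Finset.sum_mul, Finset.mul_sum]
    rw [Finset.sum_comm]
    simp only [mul_assoc]
  refine ⟨fun z => ∑ x, u x * w (x + z),
    fun z => Finset.sum_nonneg fun x _ => mul_nonneg (u0 x) (w0 _), ?_, ?_⟩
  · have h1 := hν fun _ => 1
    simp only [mul_one] at h1
    have h2 : ∀ x, ∑ z, w (x + z) = 1 := fun x => (Equiv.sum_comp (Equiv.addLeft x) w).trans w1
    simp only [h1, h2, mul_one, u1]
  · intro v hv
    have h1 : ∑ z, (∑ x, u x * w (x + z)) * (if z ∈ S then 1 else 0) = ∑ x, u x * g x := by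
      rw [hν]; simp only [hgw]
    have h2 : ∑ z, (∑ x, u x * w (x + z)) * (if z - v ∈ S then 1 else 0) =
        ∑ z, (∑ x, u x * w (x + (z + v))) * (if z ∈ S then 1 else 0) := by
      rw [← Equiv.sum_comp (Equiv.addRight v)]
      simp
    have h3 : ∑ z, (∑ x, u x * w (x + z)) * (if z ∈ S then 1 else 0) -
        ∑ z, (∑ x, u x * w (x + (z + v))) * (if z ∈ S then 1 else 0) ≤
        ∑ _z : G, 2 * (1 / 2) ^ k * (1 / (A.card : ℝ)) := by
      rw [← Finset.sum_sub_distrib]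
      refine Finset.sum_le_sum fun z _ => ?_
      have h4 := htrans v hv z
      rw [w2] at h4
      rw [← sub_mul, ← Finset.sum_sub_distrib]
      simp only [← mul_sub]
      split_ifs
      · rw [mul_one]; exact (le_abs_self _).trans h4
      · rw [mul_zero]; positivity
    rw [h1] at h3
    rw [h2]
    simp only [Finset.sum_const, Finset.card_univ, nsmul_eq_mul] at h3
    have h5 : (Fintype.card G : ℝ) * (2 * (1 / 2) ^ k * (1 / (A.card : ℝ))) =
        2 * (1 / 2) ^ k * (Fintype.card G / A.card) := by ring
    linarith

/-- Dot products with a nontrivial additive character give a complete family of characters. -/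
theorem exists_dotProduct_characters (F : Type*) [Field F] [Fintype F] (n : ℕ) :
    ∃ ψ : AddChar F ℂ, ψ ≠ 1 ∧ ∃ χ : (Fin n → F) → AddChar (Fin n → F) ℂ,
      (∀ r x, χ r x = ψ (r ⬝ᵥ x)) ∧
      ∀ x, ∑ r, χ r x = if x = 0 then (Fintype.card (Fin n → F) : ℂ) else 0 := by
  obtain ⟨ψ, hψ⟩ := AddChar.exists_apply_ne_zero.2 (one_ne_zero (α := F))
  let χ : (Fin n → F) → AddChar (Fin n → F) ℂ := fun r =>
    { toFun := fun x => ψ (r ⬝ᵥ x)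
      map_zero_eq_one' := by simp
      map_add_eq_mul' := fun x y => by rw [dotProduct_add, AddChar.map_add_eq_mul] }
  have hχ : ∀ r x, χ r x = ψ (r ⬝ᵥ x) := fun r x => rfl
  refine ⟨ψ, fun h => hψ (by simp [h]), χ, hχ, fun x => ?_⟩
  split_ifs with hx
  · simp [hx]
  · have hne : χ x ≠ 1 := by
      obtain ⟨i, hi⟩ := Function.ne_iff.1 hx
      intro h
      have := hχ x (Pi.single i (x i)⁻¹)
      rw [h, dotProduct_single, mul_inv_cancel₀ hi] at this
      exact hψ (by simpa using this.symm)
    rw [← AddChar.sum_eq_zero_of_ne_one hne]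
    refine Finset.sum_congr rfl fun r _ => ?_
    rw [hχ, hχ, dotProduct_comm]

theorem two_pow_le_exp (a : ℕ) : (2 : ℝ) ^ a ≤ Real.exp a := by
  have h : (2 : ℝ) ≤ Real.exp 1 := by linarith [Real.add_one_le_exp (1 : ℝ)]
  calc (2 : ℝ) ^ a ≤ Real.exp 1 ^ a := by gcongr
    _ = Real.exp a := by rw [← Real.exp_nat_mul, mul_one]

theorem mul_two_pow_mul_exp_neg_le {δ X : ℝ} (hδ : 0 < δ) {k a : ℕ} (hk : 1 ≤ k) (hak : a ≤ k)
    (hX : (2 + 16 / δ) * k ≤ X) : 4 * (2 : ℝ) ^ a * Real.exp (-X) ≤ δ / (4 * k) := by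
  have hk1 : (1 : ℝ) ≤ k := by exact_mod_cast hk
  have h1 : (2 : ℝ) ^ a ≤ Real.exp k :=
    (two_pow_le_exp a).trans (Real.exp_le_exp.2 (by exact_mod_cast hak))
  have h2 : (k : ℝ) ≤ Real.exp k := by linarith [Real.add_one_le_exp (k : ℝ)]
  have h3 : 16 / δ ≤ Real.exp (16 / δ * k) := by
    have h4 : 16 / δ * 1 ≤ 16 / δ * k := by gcongr
    linarith [Real.add_one_le_exp (16 / δ * k)]
  have h5 : Real.exp k * Real.exp k * Real.exp (16 / δ * k) ≤ Real.exp X := by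
    rw [← Real.exp_add, ← Real.exp_add]
    exact Real.exp_le_exp.2 (by linarith)
  have h6 : (2 : ℝ) ^ a * k * (16 / δ) ≤ Real.exp X := by
    refine le_trans ?_ h5
    gcongr
  rw [Real.exp_neg, le_div_iff₀ (by positivity), ← div_eq_mul_inv, div_mul_eq_mul_div,
    div_le_iff₀ (Real.exp_pos X)]
  calc 4 * (2 : ℝ) ^ a * (4 * k) = δ * ((2 : ℝ) ^ a * k * (16 / δ)) := by field_simp; ring
    _ ≤ δ * Real.exp X := by gcongr

/-- If most differences of a dense set lie in `S`, then a probability weight is concentrated on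
`S`, uniformly under translations annihilated by the large spectrum of a dense set. -/
theorem exists_weight_of_dense {δ : ℝ} (hδ0 : 0 < δ) (hδ1 : δ ≤ 1) :
    ∃ c : ℕ, ∀ (G ι : Type) [Fintype G] [AddCommGroup G] [Fintype ι] (χ : ι → AddChar G ℂ),
      (∀ x, ∑ r, χ r x = if x = 0 then (Fintype.card G : ℂ) else 0) →
      ∀ a : ℕ, 1 ≤ a → ∀ A S : Finset G, (Fintype.card G : ℝ) ≤ 2 ^ a * A.card →
      (1 - δ) * (A.card : ℝ) ^ 2 ≤ ∑ t ∈ A, ∑ s ∈ A, (if s - t ∈ S then (1 : ℝ) else 0) →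
      ∃ T : Finset G, T.Nonempty ∧ (Fintype.card G : ℝ) ≤ 2 ^ (c * a ^ 4) * T.card ∧
        ∃ ν : G → ℝ, (∀ z, 0 ≤ ν z) ∧ ∑ z, ν z = 1 ∧
          ∀ v, (∀ r, 1 / 2 ≤ ‖∑ t ∈ T, χ r t‖ / T.card → χ r v = 1) →
            1 - 3 * δ ≤ ∑ z, ν z * if z - v ∈ S then 1 else 0 := by
  obtain ⟨b, hb⟩ := exists_pow_lt_of_lt_one (half_pos hδ0) (by norm_num : (1 / 2 : ℝ) < 1)
  obtain ⟨c, hc⟩ := exists_nat_ge (64 * (2 + 16 / δ) / δ ^ 2)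
  rw [div_le_iff₀ (by positivity)] at hc
  refine ⟨c * (1 + b) ^ 3 + 1, fun G ι _ _ _ χ hχ a ha A S hA hAS => ?_⟩
  set N : ℝ := ((Fintype.card G : ℕ) : ℝ) with hN
  have hN0 : 0 < N := by rw [hN]; exact_mod_cast Fintype.card_pos
  have hA0 : (0 : ℝ) < A.card := pos_of_mul_pos_right (hN0.trans_le hA) (by positivity)
  have hAne : A.Nonempty := Finset.card_pos.1 (by exact_mod_cast hA0)
  obtain ⟨k, hk⟩ : ∃ k, k = a + b := ⟨_, rfl⟩
  have hk1 : (1 : ℝ) ≤ k := by exact_mod_cast (by omega : 1 ≤ k)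
  obtain ⟨m, hm⟩ : ∃ m, m = c * k ^ 3 := ⟨_, rfl⟩
  have hη0 : 0 < δ / (4 * k) := by positivity
  have hη1 : δ / (4 * k) ≤ 1 := by
    rw [div_le_one (by positivity)]
    linarith
  have hX : (2 + 16 / δ) * k ≤ (δ / (4 * k)) ^ 2 * m / 4 := by
    have e : (δ / (4 * k)) ^ 2 * m / 4 = c * δ ^ 2 / 64 * k := by
      rw [hm]; push_cast; field_simp; ring
    rw [e]
    gcongr
    linarith
  have hmA : 4 * N * Real.exp (-((δ / (4 * k)) ^ 2 * m / 4)) ≤ δ / (4 * k) * A.card := by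
    have := mul_two_pow_mul_exp_neg_le hδ0 (by omega : 1 ≤ k) (by omega : a ≤ k) hX
    calc 4 * N * Real.exp (-((δ / (4 * k)) ^ 2 * m / 4))
        ≤ 4 * (2 ^ a * A.card) * Real.exp (-((δ / (4 * k)) ^ 2 * m / 4)) := by gcongr
      _ = 4 * 2 ^ a * Real.exp (-((δ / (4 * k)) ^ 2 * m / 4)) * A.card := by ring
      _ ≤ δ / (4 * k) * A.card := by gcongr
  obtain ⟨T, hTc, hT⟩ := exists_almost_periods A S hAne m hη0 hη1 hmA _ fun _ => rfl
  have hT2 : N ≤ 2 ^ (a * m + 1) * T.card := by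
    have h1 : N ^ m ≤ 2 ^ (a * m) * (A.card : ℝ) ^ m := by
      rw [pow_mul 2 a m, ← mul_pow]; gcongr
    have h2 : N ^ m * N ≤ N ^ m * (2 ^ (a * m + 1) * T.card) := by
      calc N ^ m * N ≤ 2 ^ (a * m) * (A.card : ℝ) ^ m * N := by gcongr
        _ = 2 ^ (a * m) * ((A.card : ℝ) ^ m * N) := by ring
        _ ≤ 2 ^ (a * m) * (2 * T.card * N ^ m) := by gcongr
        _ = _ := by ring
    exact le_of_mul_le_mul_left h2 (by positivity)
  have hT0 : (0 : ℝ) < T.card := pos_of_mul_pos_right (hN0.trans_le hT2) (by positivity)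
  have hTne : T.Nonempty := Finset.card_pos.1 (by exact_mod_cast hT0)
  obtain ⟨ν, hν0, hν1, hν⟩ := exists_weight_of_almost_periods χ hχ hAne hTne hAS _
    (fun _ => rfl) hT k
  refine ⟨T, hTne, hT2.trans ?_, ν, hν0, hν1, fun v hv => le_trans ?_ (hν v hv)⟩
  · gcongr
    · norm_num
    · calc a * m + 1 = a * (c * k ^ 3) + 1 := by rw [hm]
        _ ≤ a * (c * ((1 + b) * a) ^ 3) + a ^ 4 := by
          gcongr
          · rw [hk]; nlinarith
          · exact Nat.one_le_pow _ _ ha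
        _ = _ := by ring
  · have e1 : k * (4 * (δ / (4 * k))) = δ := by field_simp
    have e2 : 2 * (1 / 2 : ℝ) ^ k * (N / A.card) ≤ δ := by
      have : N / A.card ≤ 2 ^ a := by rwa [div_le_iff₀ hA0]
      calc 2 * (1 / 2 : ℝ) ^ k * (N / A.card) ≤ 2 * (1 / 2 : ℝ) ^ k * 2 ^ a := by gcongr
        _ = 2 * (1 / 2) ^ b := by
          rw [hk, pow_add]
          have : (1 / 2 : ℝ) ^ a * 2 ^ a = 1 := by rw [← mul_pow]; norm_num
          linear_combination 2 * (1 / 2 : ℝ) ^ b * this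
        _ ≤ δ := by linarith
    linarith

/-- If most differences of a dense set lie in `S`, then a probability weight is concentrated on
`S`, uniformly under translations from a subspace of small codimension. -/
theorem exists_submodule_weight {δ : ℝ} (hδ0 : 0 < δ) (hδ1 : δ ≤ 1) :
    ∃ C : ℝ, 0 < C ∧ ∀ (F : Type) [Field F] [Fintype F] (n a : ℕ), 1 ≤ a →
      ∀ A S : Finset (Fin n → F), (Fintype.card (Fin n → F) : ℝ) ≤ 2 ^ a * A.card →
      (1 - δ) * (A.card : ℝ) ^ 2 ≤ ∑ t ∈ A, ∑ s ∈ A, (if s - t ∈ S then (1 : ℝ) else 0) →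
      ∃ V : Submodule F (Fin n → F), (n : ℝ) - Module.finrank F V ≤ C * a ^ 4 ∧
        ∃ ν : (Fin n → F) → ℝ, (∀ z, 0 ≤ ν z) ∧ ∑ z, ν z = 1 ∧
          ∀ v ∈ V, 1 - 3 * δ ≤ ∑ z, ν z * if z - v ∈ S then 1 else 0 := by
  obtain ⟨c, hc⟩ := exists_weight_of_dense hδ0 hδ1
  refine ⟨16 * (c + 1), by positivity, fun F _ _ n a ha A S hA hAS => ?_⟩
  obtain ⟨ψ, hψ, χ, hχ, hχsum⟩ := exists_dotProduct_characters F n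
  obtain ⟨T, hTne, hT, ν, hν0, hν1, hν⟩ := hc (Fin n → F) (Fin n → F) χ
    (fun x => by convert hχsum x) a ha A S hA (by convert hAS)
  have hT0 : (0 : ℝ) < T.card := by exact_mod_cast hTne.card_pos
  obtain ⟨V, r, hVr, hr, hV⟩ := exists_submodule_annihilating_spectrum ψ hψ T hTne
  refine ⟨V, ?_, ν, hν0, hν1, fun v hv => ?_⟩
  · have h1 : Real.exp (r / 16) ≤ Real.exp ((c * a ^ 4 : ℕ) : ℝ) :=
      (le_of_mul_le_mul_right (hr.trans hT) hT0).trans (two_pow_le_exp _)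
    have h2 := Real.exp_le_exp.1 h1
    have h3 : (n : ℝ) ≤ Module.finrank F V + r := by exact_mod_cast hVr
    have h4 : (0 : ℝ) ≤ (a : ℝ) ^ 4 := by positivity
    push_cast at h2
    linarith
  · convert hν v fun x hx => ?_
    rw [hχ]
    refine hV x ?_ v hv
    simpa only [hχ] using hx

theorem sum_ind {G : Type*} [Fintype G] (A : Set G) : ∑ x, ind A x = Nat.card A := by
  simp only [ind, Set.indicator_apply, Finset.sum_boole, Nat.card_eq_fintype_card,
    Fintype.card_subtype]

theorem ind_image_add {G : Type*} [AddCommGroup G] (A : Set G) (g x : G) :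
    ind ((fun a => a + g) '' A) x = ind A (x - g) := by
  have h : x ∈ (fun a => a + g) '' A ↔ x - g ∈ A := by
    simp [sub_eq_add_neg]
  simp only [ind, Set.indicator_apply, h]

theorem muFun_div_card {G : Type*} [Fintype G] [Nonempty G] (f : G → ℝ) {q : ℝ}
    (h : ∑ x, f x = q * Fintype.card G) (x : G) :
    muFun (fun y => f y / Fintype.card G) x = f x / q := by
  have hN : (0 : ℝ) < Fintype.card G := by exact_mod_cast Fintype.card_pos
  rw [muFun, expect, ← Finset.sum_div, h, mul_div_assoc, div_self hN.ne', mul_one]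
  field_simp

theorem sum_corr_translate {G ι : Type*} [Fintype G] [AddCommGroup G] [Fintype ι]
    (b : ι → G → ℝ) (σ : ι → G) :
    ∑ x, ∑ g, ∑ y, b g y * b g (x + y - σ g) = ∑ g, (∑ y, b g y) ^ 2 := by
  rw [Finset.sum_comm]
  refine Finset.sum_congr rfl fun g _ => ?_
  rw [Finset.sum_comm, sq, Finset.sum_mul]
  refine Finset.sum_congr rfl fun y _ => ?_
  rw [← Finset.mul_sum]
  congr 1
  refine Fintype.sum_equiv (Equiv.addRight (y - σ g)) _ _ fun x => ?_
  simp [add_sub_assoc]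

/-- Sup norm lower bound for an average over `V`, by testing against a probability weight. -/
theorem le_supNorm_conv_muSet {G : Type*} [Fintype G] [AddCommGroup G] {V : Set G}
    (hV : V.Nonempty) {f ν : G → ℝ} {S : Finset G} {θ κ : ℝ} (hf : ∀ x, 0 ≤ f x) (hθ : 0 ≤ θ)
    (hfS : ∀ x ∈ S, θ ≤ f x) (hν0 : ∀ z, 0 ≤ ν z) (hν1 : ∑ z, ν z = 1)
    (hν : ∀ v ∈ V, κ ≤ ∑ z, ν z * if z - v ∈ S then 1 else 0) :
    θ * κ ≤ supNorm (conv f (muSet V)) := by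
  have hN : (0 : ℝ) < Fintype.card G := by exact_mod_cast Fintype.card_pos
  have hV0 : (0 : ℝ) < Nat.card V := by
    have := hV.to_subtype
    exact_mod_cast Nat.card_pos
  have h1 : ∀ z, conv f (muSet V) z = (∑ v, ind V v * f (z - v)) / Nat.card V := by
    intro z
    have e : ∑ y, f y * muSet V (z - y) = ∑ v, f (z - v) * muSet V v :=
      Fintype.sum_equiv (Equiv.subLeft z) _ _ fun y => by simp
    rw [conv, expect, e]
    simp only [muSet, Finset.sum_div]
    refine Finset.sum_congr rfl fun v _ => ?_
    field_simp
  have h2 : ∑ z, ν z * conv f (muSet V) z =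
      (∑ v, ind V v * ∑ z, ν z * f (z - v)) / Nat.card V := by
    simp only [h1, Finset.mul_sum, Finset.sum_div]
    rw [Finset.sum_comm]
    refine Finset.sum_congr rfl fun v _ => Finset.sum_congr rfl fun z _ => ?_
    ring
  have h3 : ∀ v, ind V v * (θ * κ) ≤ ind V v * ∑ z, ν z * f (z - v) := by
    intro v
    by_cases hv : v ∈ V
    · simp only [ind, Set.indicator_of_mem hv, one_mul]
      refine (mul_le_mul_of_nonneg_left (hν v hv) hθ).trans ?_
      rw [Finset.mul_sum]
      refine Finset.sum_le_sum fun z _ => ?_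
      split_ifs with hz
      · nlinarith [hν0 z, hfS _ hz]
      · simpa using mul_nonneg (hν0 z) (hf (z - v))
    · simp [ind, hv]
  have h4 : θ * κ ≤ ∑ z, ν z * conv f (muSet V) z := by
    rw [h2, le_div_iff₀ hV0, ← sum_ind, mul_comm, Finset.sum_mul]
    exact Finset.sum_le_sum fun v _ => h3 v
  refine h4.trans ?_
  calc ∑ z, ν z * conv f (muSet V) z ≤ ∑ z, ν z * supNorm (conv f (muSet V)) :=
        Finset.sum_le_sum fun z _ => mul_le_mul_of_nonneg_left
          ((le_abs_self _).trans (le_ciSup (f := fun x => |conv f (muSet V) x|)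
            (Set.finite_range _).bddAbove z)) (hν0 z)
    _ = supNorm (conv f (muSet V)) := by rw [← Finset.sum_mul, hν1, one_mul]

theorem exists_mul_pow_le {ε δ : ℝ} (hε0 : 0 < ε) (hε1 : ε < 1) (hδ0 : 0 < δ) (hδ1 : δ ≤ 1) :
    ∃ c : ℕ, ∀ D : ℕ, 1 ≤ D →
      4 * 2 ^ D * (1 + ε / 8) ^ (c * D) ≤ δ * (1 + ε) ^ (c * D) := by
  obtain ⟨c, hc⟩ := pow_unbounded_of_one_lt (8 / δ) (by linarith : 1 < 1 + ε / 2)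
  refine ⟨c, fun D hD => ?_⟩
  have h1 : (1 + ε / 8) * (1 + ε / 2) ≤ 1 + ε := by nlinarith
  have h2 : 4 * 2 ^ D ≤ δ * (8 / δ) ^ D := by
    obtain ⟨D, rfl⟩ := Nat.exists_eq_add_of_le hD
    have h3 : (2 : ℝ) ≤ 8 / δ := by rw [le_div_iff₀ hδ0]; linarith
    rw [pow_add, pow_add, pow_one, pow_one, ← mul_assoc δ, mul_div_cancel₀ _ hδ0.ne']
    have : (2 : ℝ) ^ D ≤ (8 / δ) ^ D := by gcongr
    linarith
  calc 4 * 2 ^ D * (1 + ε / 8) ^ (c * D) ≤ δ * (8 / δ) ^ D * (1 + ε / 8) ^ (c * D) := by gcongr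
    _ ≤ δ * ((1 + ε / 2) ^ c) ^ D * (1 + ε / 8) ^ (c * D) := by gcongr
    _ = δ * ((1 + ε / 8) * (1 + ε / 2)) ^ (c * D) := by rw [mul_pow, ← pow_mul]; ring
    _ ≤ δ * (1 + ε) ^ (c * D) := by gcongr

/-- If `μ_F` and `μ_D` are far from uncorrelated, then most differences of some dense set are
points where `μ_{F'}` is large. -/
theorem exists_dense_of_inprod_far {G : Type*} [Fintype G] [AddCommGroup G] (A : G → Set G)
    (D K : ℕ) {ε δ : ℝ} (hε0 : 0 ≤ ε) (hε1 : ε ≤ 1) (hδ : 0 < δ)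
    (hA : (Fintype.card G : ℝ) ^ 2 ≤ 2 ^ D * ∑ g, (Nat.card (A g) : ℝ))
    (hK : 4 * 2 ^ D * (1 + ε / 8) ^ K ≤ δ * (1 + ε) ^ K)
    (h : ε < |inprod (muFun fun y => ∑ g, dconv (ind (A g)) (ind ((fun a => a + g) '' A g)) y)
      (muFun fun x => (Nat.card (A x) : ℝ)) - 1|) :
    ∃ B S : Finset G, (Fintype.card G : ℝ) ≤ 2 ^ (D * (K + 1) + 3) * B.card ∧
      (1 - δ) * (B.card : ℝ) ^ 2 ≤ ∑ t ∈ B, ∑ s ∈ B, (if s - t ∈ S then (1 : ℝ) else 0) ∧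
      (∀ x, 0 ≤ muFun (fun y => ∑ g, dconv (ind (A g)) (ind (A g)) y) x) ∧
      ∀ x ∈ S, 1 + ε / 8 ≤ muFun (fun y => ∑ g, dconv (ind (A g)) (ind (A g)) y) x := by
  set N : ℝ := ((Fintype.card G : ℕ) : ℝ) with hN
  have hN0 : 0 < N := by rw [hN]; exact_mod_cast Fintype.card_pos
  set P : ℝ := ∑ g, (Nat.card (A g) : ℝ) with hP
  have hP0 : 0 < P := pos_of_mul_pos_right ((by positivity : 0 < N ^ 2).trans_le hA) (by positivity)
  obtain ⟨q, hq⟩ : ∃ q, q = ∑ g, (∑ y, ind (A g) y) ^ 2 / N := ⟨_, rfl⟩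
  have hqN : ∑ g, (∑ y, ind (A g) y) ^ 2 = q * N := by
    rw [hq, ← Finset.sum_div]; field_simp
  have hCS : P ^ 2 ≤ N ^ 2 * q := by
    have := sq_sum_le_card_mul_sum_sq (s := Finset.univ) (f := fun g => (Nat.card (A g) : ℝ))
    simp only [sum_ind] at hqN
    rw [hqN, Finset.card_univ] at this
    linarith
  have hq0 : 0 < q := pos_of_mul_pos_right ((by positivity : 0 < P ^ 2).trans_le hCS) (by positivity)
  have hPq : P ≤ 2 ^ D * q := by
    have h1 : P * P ≤ (2 ^ D * q) * P := by
      have := mul_le_mul_of_nonneg_right hA hq0.le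
      linarith
    exact le_of_mul_le_mul_right h1 hP0
  have hρ' : ∀ x, muFun (fun y => ∑ g, dconv (ind (A g)) (ind ((fun a => a + g) '' A g)) y) x =
      (∑ g, ∑ y, ind (A g) y * ind (A g) (x + y - g)) / q := by
    intro x
    rw [← muFun_div_card _ ((sum_corr_translate (fun g => ind (A g)) fun g => g).trans hqN)]
    simp only [dconv, expect, ind_image_add, Finset.sum_div]
  have hρ : ∀ x, muFun (fun y => ∑ g, dconv (ind (A g)) (ind (A g)) y) x =
      (∑ g, ∑ y, ind (A g) y * ind (A g) (x + y)) / q := by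
    intro x
    have e : ∑ x, ∑ g, ∑ y, ind (A g) y * ind (A g) (x + y) = q * N := by
      simpa using (sum_corr_translate (fun g => ind (A g)) fun _ => 0).trans hqN
    rw [← muFun_div_card (fun x => ∑ g, ∑ y, ind (A g) y * ind (A g) (x + y)) e]
    simp only [dconv, expect, Finset.sum_div]
  have hw : ∀ x, muFun (fun x => (Nat.card (A x) : ℝ)) x = Nat.card (A x) * N / P := by
    intro x
    rw [muFun, expect, ← hP, div_div_eq_mul_div]
  have hw1 : ∑ x, (Nat.card (A x) * N / P) = N := by
    rw [← Finset.sum_div, ← Finset.sum_mul, ← hP]; field_simp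
  have hwM : ∀ x, Nat.card (A x) * N / P ≤ 2 ^ D := by
    intro x
    have : (Nat.card (A x) : ℝ) ≤ N := by
      rw [hN, ← Nat.card_eq_fintype_card]
      exact_mod_cast Finite.card_subtype_le _
    rw [div_le_iff₀ hP0]
    nlinarith
  have hb : ∀ g y, ind (A g) y = 0 ∨ ind (A g) y = 1 := fun g y => by
    by_cases hy : y ∈ A g <;> simp [ind, hy]
  obtain ⟨B, hB1, hB2⟩ := exists_dense_of_correlation (fun g => ind (A g)) hb (fun g => g)
    (fun x => Nat.card (A x) * N / P) D K hq0 hq hε0 hε1 hδ (fun x => by positivity) hwM hw1 (by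
      have e : inprod (muFun fun y => ∑ g, dconv (ind (A g)) (ind ((fun a => a + g) '' A g)) y)
          (muFun fun x => (Nat.card (A x) : ℝ)) - 1 = (∑ x, Nat.card (A x) * N / P *
            ((∑ g, ∑ y, ind (A g) y * ind (A g) (x + y - g)) / q - 1)) / N := by
        simp only [inprod, expect, hρ', hw, mul_sub, mul_one, Finset.sum_sub_distrib, hw1, sub_div]
        rw [div_self hN0.ne']
        congr 2
        exact Finset.sum_congr rfl fun x _ => mul_comm _ _
      rw [e, abs_div, abs_of_pos hN0, lt_div_iff₀ hN0] at h
      exact h.le) (by simpa only [sum_ind] using hPq) hK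
  refine ⟨B, _, hB1, hB2, fun x => ?_, fun x hx => ?_⟩
  · rw [hρ]
    refine div_nonneg (Finset.sum_nonneg fun g _ => Finset.sum_nonneg fun y _ => ?_) hq0.le
    rcases hb g y with h1 | h1 <;> rcases hb g (x + y) with h2 | h2 <;> simp [h1, h2]
  · rw [hρ, le_div_iff₀ hq0, mul_comm]
    simpa using hx

theorem statement9 (ε : ℝ) (hε0 : 0 < ε) (hε1 : ε < 1) :
    ∃ C : ℝ, 0 < C ∧ ∀ (F : Type) [Field F] [Fintype F], ∀ n : ℕ, 1 ≤ n →
      ∀ d : ℝ, 0 ≤ d → ∀ A : (Fin n → F) → Set (Fin n → F),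
        (2 : ℝ) ^ (-d) * (Fintype.card F : ℝ) ^ (2 * n) ≤ ∑ g, (Nat.card (A g) : ℝ) →
        |inprod (muFun (fun y => ∑ g, dconv (ind (A g)) (ind ((fun a => a + g) '' A g)) y))
            (muFun (fun x => (Nat.card (A x) : ℝ))) - 1| ≤ ε ∨
        ∃ V : Submodule F (Fin n → F),
          (n : ℝ) - (Module.finrank F V : ℝ) ≤ C * (d + 1) ^ 8 ∧
          1 + ε / 32 ≤ supNorm (conv
            (muFun (fun y => ∑ g, dconv (ind (A g)) (ind (A g)) y))
            (muSet (V : Set (Fin n → F)))) := by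
  have hδ0 : 0 < ε / 48 := by positivity
  have hδ1 : ε / 48 ≤ 1 := by linarith
  obtain ⟨c, hc⟩ := exists_mul_pow_le hε0 hε1 hδ0 hδ1
  obtain ⟨C, hC0, hC⟩ := exists_submodule_weight hδ0 hδ1
  refine ⟨C * ((c + 4) * 2 ^ 2) ^ 4, by positivity, fun F _ _ n _ d hd A hA => ?_⟩
  by_cases hfar : |inprod (muFun (fun y => ∑ g, dconv (ind (A g)) (ind ((fun a => a + g) '' A g)) y))
      (muFun (fun x => (Nat.card (A x) : ℝ))) - 1| ≤ ε
  · exact Or.inl hfar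
  refine Or.inr ?_
  obtain ⟨D, hD⟩ : ∃ D, D = ⌈d⌉₊ + 1 := ⟨_, rfl⟩
  have hdD : d ≤ D := by rw [hD]; push_cast; linarith [Nat.le_ceil d]
  have hDd : (D : ℝ) ≤ 2 * (d + 1) := by rw [hD]; push_cast; linarith [Nat.ceil_lt_add_one hd]
  have hAD : (Fintype.card (Fin n → F) : ℝ) ^ 2 ≤ 2 ^ D * ∑ g, (Nat.card (A g) : ℝ) := by
    have h1 : (2 : ℝ) ^ (-(D : ℝ)) ≤ 2 ^ (-d) :=
      Real.rpow_le_rpow_of_exponent_le (by norm_num) (by linarith)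
    rw [Real.rpow_neg (by norm_num), Real.rpow_natCast] at h1
    have h2 : ((2 : ℝ) ^ D)⁻¹ * (Fintype.card (Fin n → F) : ℝ) ^ 2 ≤
        ∑ g, (Nat.card (A g) : ℝ) := by
      refine le_trans ?_ hA
      have e : (Fintype.card (Fin n → F) : ℝ) ^ 2 = (Fintype.card F : ℝ) ^ (2 * n) := by
        rw [Fintype.card_fun, Fintype.card_fin]; push_cast; rw [← pow_mul, mul_comm n]
      rw [e]
      gcongr
    rwa [inv_mul_le_iff₀ (by positivity)] at h2
  obtain ⟨B, S, hB, hBS, hf0, hfS⟩ := exists_dense_of_inprod_far A D (c * D) hε0.le hε1.le hδ0 hAD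
    (hc D (by omega)) (not_le.1 hfar)
  obtain ⟨V, hV, ν, hν0, hν1, hν⟩ := hC F n (D * (c * D + 1) + 3) (by omega) B S hB
    (by convert hBS)
  refine ⟨V, hV.trans ?_, ?_⟩
  · have h1 : (1 : ℝ) ≤ D := by exact_mod_cast (by omega : 1 ≤ D)
    calc C * ((D * (c * D + 1) + 3 : ℕ) : ℝ) ^ 4 ≤ C * ((c + 4) * (2 * (d + 1)) ^ 2) ^ 4 := by
          gcongr
          calc ((D * (c * D + 1) + 3 : ℕ) : ℝ) ≤ (c + 4) * (D : ℝ) ^ 2 := by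
                push_cast; nlinarith
            _ ≤ _ := by gcongr
      _ = _ := by ring
  · refine le_trans ?_ (le_supNorm_conv_muSet (κ := 1 - 3 * (ε / 48)) ⟨0, V.zero_mem⟩ hf0
      (by positivity : 0 ≤ 1 + ε / 8) hfS hν0 hν1 fun v hv => ?_)
    · nlinarith
    · convert hν v hv

end SkewPaper
end
end

section
/- For every ε ∈ (0,1) there exists a constant C = C(ε) > 0 such that the following holds. Let q be a prime power, n ≥ 1, d ≥ 0, and M₁, M₂, S ⊆ 𝔽_q^n with M₁ and M₂ both of density at least 2^{−d} in 𝔽_q^n. If ⟨μ_{M₁} ∘ μ_{M₂}, 1_S⟩ ≥ 1 − ε/2, then there exists a subspace V ⊆ 𝔽_q^n of codimension at most C(d+1)⁴ such that ⟨μ_V ∗ μ_{M₁} ∘ μ_{M₂}, 1_S⟩ ≥ 1 − ε. -/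
open scoped BigOperators Classical

noncomputable section

namespace SkewPaper

variable {G : Type*}

/-! ### Exponential moments and almost-periodicity -/

lemma sum_exp_mul_le {α : Type*} (s : Finset α) (X : α → ℝ) (hX : ∀ a ∈ s, |X a| ≤ 1)
    (h0 : ∑ a ∈ s, X a = 0) (l : ℝ) :
    ∑ a ∈ s, Real.exp (l * X a) ≤ s.card * Real.exp (l ^ 2 / 2) := by
  calc ∑ a ∈ s, Real.exp (l * X a)
      ≤ ∑ a ∈ s, (Real.cosh l + X a * Real.sinh l) := by
        refine Finset.sum_le_sum fun a ha => ?_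
        rw [mul_comm]
        exact Real.exp_mul_le_cosh_add_mul_sinh (hX a ha) l
    _ = s.card * Real.cosh l := by
        rw [Finset.sum_add_distrib, ← Finset.sum_mul, h0]
        simp
    _ ≤ _ := by
        gcongr
        exact Real.cosh_le_exp_half_sq l

lemma sum_piFinset_exp_le {α : Type*} (s : Finset α) (X : α → ℝ) (hX : ∀ a ∈ s, |X a| ≤ 1)
    (h0 : ∑ a ∈ s, X a = 0) (l : ℝ) (m : ℕ) :
    ∑ a ∈ Fintype.piFinset (fun _ : Fin m => s), Real.exp (l * ∑ i, X (a i))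
      ≤ (s.card : ℝ) ^ m * Real.exp (l ^ 2 / 2 * m) := by
  have h1 : ∑ a ∈ Fintype.piFinset (fun _ : Fin m => s), Real.exp (l * ∑ i, X (a i))
      = (∑ a ∈ s, Real.exp (l * X a)) ^ m := by
    have := Finset.sum_prod_piFinset (ι := Fin m) s (fun _ a => Real.exp (l * X a))
    simp only [Finset.prod_const, Finset.card_univ, Fintype.card_fin] at this
    rw [← this]
    refine Finset.sum_congr rfl fun a _ => ?_
    rw [← Real.exp_sum, Finset.mul_sum]
  rw [h1]
  calc _ ≤ (s.card * Real.exp (l ^ 2 / 2)) ^ m :=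
        pow_le_pow_left₀ (Finset.sum_nonneg fun _ _ => (Real.exp_pos _).le)
          (sum_exp_mul_le s X hX h0 l) m
    _ = _ := by rw [mul_pow, ← Real.exp_nat_mul, mul_comm (m : ℝ)]

/-- Hoeffding's inequality for independent samples from a finite set, in counting form. -/
lemma card_deviation_le {α : Type*} (s : Finset α) (X : α → ℝ) (hX : ∀ a ∈ s, |X a| ≤ 1)
    (h0 : ∑ a ∈ s, X a = 0) (m : ℕ) (η : ℝ) (hη : 0 < η) :
    (((Fintype.piFinset (fun _ : Fin m => s)).filter
      (fun a => η * m < |∑ i, X (a i)|)).card : ℝ)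
      ≤ 2 * (s.card : ℝ) ^ m * Real.exp (-(η ^ 2 / 2 * m)) := by
  have hsplit : (2 * (s.card : ℝ) ^ m * Real.exp (-(η ^ 2 / 2 * m))) =
      Real.exp (-(η ^ 2 * m)) * ((s.card : ℝ) ^ m * Real.exp (η ^ 2 / 2 * m)
        + (s.card : ℝ) ^ m * Real.exp ((-η) ^ 2 / 2 * m)) := by
    have : Real.exp (-(η ^ 2 / 2 * m)) =
        Real.exp (-(η ^ 2 * m)) * Real.exp (η ^ 2 / 2 * m) := by
      rw [← Real.exp_add]; congr 1; ring
    rw [this, neg_sq]; ring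
  rw [hsplit]
  calc _ = ∑ a ∈ (Fintype.piFinset (fun _ : Fin m => s)).filter
          (fun a => η * m < |∑ i, X (a i)|), (1 : ℝ) := by simp
    _ ≤ ∑ a ∈ (Fintype.piFinset (fun _ : Fin m => s)).filter
          (fun a => η * m < |∑ i, X (a i)|), Real.exp (-(η ^ 2 * m)) *
        (Real.exp (η * (∑ i, X (a i))) + Real.exp (-η * ∑ i, X (a i))) := by
        refine Finset.sum_le_sum fun a ha => ?_
        have ha := (Finset.mem_filter.1 ha).2
        rw [mul_add, ← Real.exp_add, ← Real.exp_add]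
        rcases lt_abs.1 ha with h | h
        · have h1 : 1 ≤ Real.exp (-(η ^ 2 * m) + η * ∑ i, X (a i)) := by
            rw [Real.one_le_exp_iff]
            nlinarith
          linarith [Real.exp_pos (-(η ^ 2 * m) + -η * ∑ i, X (a i))]
        · have h1 : 1 ≤ Real.exp (-(η ^ 2 * m) + -η * ∑ i, X (a i)) := by
            rw [Real.one_le_exp_iff]
            nlinarith
          linarith [Real.exp_pos (-(η ^ 2 * m) + η * ∑ i, X (a i))]
    _ ≤ ∑ a ∈ Fintype.piFinset (fun _ : Fin m => s), Real.exp (-(η ^ 2 * m)) *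
        (Real.exp (η * (∑ i, X (a i))) + Real.exp (-η * ∑ i, X (a i))) :=
        Finset.sum_le_sum_of_subset_of_nonneg (Finset.filter_subset _ _)
          fun _ _ _ => by positivity
    _ ≤ _ := by
        rw [← Finset.mul_sum, Finset.sum_add_distrib]
        gcongr
        · exact sum_piFinset_exp_le s X hX h0 η m
        · exact sum_piFinset_exp_le s X hX h0 (-η) m

/-- The average of `f` over the set `x - M`. -/
def avgOver [AddCommGroup G] (M : Finset G) (f : G → ℝ) (x : G) : ℝ :=
  (∑ a ∈ M, f (x - a)) / M.card

/-- The set of points where the empirical average of `f` over the sample `a` misses the average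
over `M` by more than `η`. -/
def badPoints [Fintype G] [AddCommGroup G] (M : Finset G) (f : G → ℝ) (η : ℝ) {m : ℕ}
    (a : Fin m → G) : Finset G :=
  Finset.univ.filter fun x => η < |(∑ i, f (x - a i)) / m - avgOver M f x|

lemma card_bad_samples_le [AddCommGroup G] (M : Finset G) (hM : M.Nonempty)
    (f : G → ℝ) (hf : ∀ x, 0 ≤ f x ∧ f x ≤ 1) (m : ℕ) (hm : 0 < m) (η : ℝ) (hη : 0 < η) (x : G) :
    (((Fintype.piFinset (fun _ : Fin m => M)).filter
      (fun a => η < |(∑ i, f (x - a i)) / m - avgOver M f x|)).card : ℝ)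
      ≤ 2 * (M.card : ℝ) ^ m * Real.exp (-(η ^ 2 / 2 * m)) := by
  have hc : (0 : ℝ) < M.card := by exact_mod_cast hM.card_pos
  have hg0 : 0 ≤ avgOver M f x := div_nonneg (Finset.sum_nonneg fun a _ => (hf _).1) hc.le
  have hg1 : avgOver M f x ≤ 1 := by
    rw [avgOver, div_le_one hc]
    calc _ ≤ ∑ a ∈ M, (1 : ℝ) := Finset.sum_le_sum fun a _ => (hf _).2
      _ = _ := by simp
  have hm' : (0 : ℝ) < m := by exact_mod_cast hm
  have key := card_deviation_le M (fun a => f (x - a) - avgOver M f x)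
    (fun a _ => abs_le.2 ⟨by linarith [(hf (x - a)).1], by linarith [(hf (x - a)).2]⟩)
    (by
      rw [Finset.sum_sub_distrib, Finset.sum_const, nsmul_eq_mul, avgOver]
      field_simp
      simp) m η hη
  refine le_trans (le_of_eq ?_) key
  congr 2
  refine Finset.filter_congr fun a _ => ?_
  have : (∑ i, (f (x - a i) - avgOver M f x)) =
      ((∑ i, f (x - a i)) / m - avgOver M f x) * m := by
    rw [Finset.sum_sub_distrib]
    simp
    field_simp
  rw [this, abs_mul, abs_of_pos hm']
  exact (mul_lt_mul_iff_left₀ hm').symm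

lemma exists_good_samples [Fintype G] [AddCommGroup G] (M : Finset G) (hM : M.Nonempty)
    (f : G → ℝ) (hf : ∀ x, 0 ≤ f x ∧ f x ≤ 1) (m : ℕ) (hm : 0 < m) (η β : ℝ) (hη : 0 < η)
    (hβ : 0 < β) (hmβ : 4 * Real.exp (-(η ^ 2 / 2 * m)) ≤ β) :
    ∃ L : Finset (Fin m → G), M.card ^ m ≤ 2 * L.card ∧
      ∀ a ∈ L, ((badPoints M f η a).card : ℝ) ≤ β * Fintype.card G := by
  set P := Fintype.piFinset (fun _ : Fin m => M) with hP
  have hPc : P.card = M.card ^ m := by simp [hP]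
  refine ⟨P.filter fun a => ((badPoints M f η a).card : ℝ) ≤ β * Fintype.card G, ?_,
    fun a ha => (Finset.mem_filter.1 ha).2⟩
  have hN : (0 : ℝ) < Fintype.card G := by exact_mod_cast Fintype.card_pos
  have hdc : ∑ a ∈ P, ((badPoints M f η a).card : ℝ)
      ≤ Fintype.card G * (2 * (M.card : ℝ) ^ m * Real.exp (-(η ^ 2 / 2 * m))) := by
    have : ∑ a ∈ P, ((badPoints M f η a).card : ℝ) = ∑ x : G, ((P.filter
      (fun a => η < |(∑ i, f (x - a i)) / m - avgOver M f x|)).card : ℝ) := by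
      simp only [badPoints, Finset.card_filter, Nat.cast_sum]
      exact Finset.sum_comm
    rw [this]
    calc _ ≤ ∑ x : G, (2 * (M.card : ℝ) ^ m * Real.exp (-(η ^ 2 / 2 * m))) :=
          Finset.sum_le_sum fun x _ => card_bad_samples_le M hM f hf m hm η hη x
      _ = _ := by simp
  have hlow : ((P.filter fun a => ¬ ((badPoints M f η a).card : ℝ) ≤ β * Fintype.card G).card : ℝ)
      * (β * Fintype.card G) ≤ ∑ a ∈ P, ((badPoints M f η a).card : ℝ) := by
    rw [← nsmul_eq_mul]
    refine le_trans (Finset.card_nsmul_le_sum _ (fun a => ((badPoints M f η a).card : ℝ)) _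
      fun a ha => (not_le.1 (Finset.mem_filter.1 ha).2).le) ?_
    exact Finset.sum_le_sum_of_subset_of_nonneg (Finset.filter_subset _ _)
      fun _ _ _ => by positivity
  have hsum := Finset.card_filter_add_card_filter_not (s := P)
    (fun a => ((badPoints M f η a).card : ℝ) ≤ β * Fintype.card G)
  have hmain : 2 * ((P.filter fun a =>
      ¬ ((badPoints M f η a).card : ℝ) ≤ β * Fintype.card G).card : ℝ) ≤ (M.card : ℝ) ^ m := by
    have h1 := hlow.trans hdc
    have h2 : (Fintype.card G : ℝ) * (2 * (M.card : ℝ) ^ m * Real.exp (-(η ^ 2 / 2 * m)))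
        ≤ Fintype.card G * ((M.card : ℝ) ^ m * (β / 2)) := by
      rw [show 2 * (M.card : ℝ) ^ m * Real.exp (-(η ^ 2 / 2 * m)) =
        (M.card : ℝ) ^ m * (2 * Real.exp (-(η ^ 2 / 2 * m))) by ring]
      gcongr
      linarith
    have h3 := h1.trans h2
    have hpos : 0 < β * Fintype.card G := by positivity
    refine le_of_mul_le_mul_right ?_ hpos
    nlinarith
  have hmain' : 2 * (P.filter fun a =>
      ¬ ((badPoints M f η a).card : ℝ) ≤ β * Fintype.card G).card ≤ M.card ^ m := by
    exact_mod_cast hmain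
  omega

/-- Croot–Sisask almost-periodicity, with exceptional sets in place of `L^p` norms. -/
lemma exists_almost_periods_s15 [Fintype G] [AddCommGroup G] (M : Finset G) (hM : M.Nonempty)
    (f : G → ℝ) (hf : ∀ x, 0 ≤ f x ∧ f x ≤ 1) (m : ℕ) (hm : 0 < m) (η β : ℝ) (hη : 0 < η)
    (hβ : 0 < β) (hmβ : 4 * Real.exp (-(η ^ 2 / 2 * m)) ≤ β) :
    ∃ T : Finset G, Fintype.card G * M.card ^ m ≤ 2 * Fintype.card G ^ m * T.card ∧
      ∀ t ∈ T, ∀ t₀ ∈ T,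
        ((Finset.univ.filter fun x =>
          2 * η < |avgOver M f (x + (t - t₀)) - avgOver M f x|).card : ℝ)
          ≤ 2 * β * Fintype.card G := by
  obtain ⟨L, hL, hLbad⟩ := exists_good_samples M hM f hf m hm η β hη hβ hmβ
  obtain ⟨y, hy⟩ : ∃ y : Fin m → G, Fintype.card G * M.card ^ m ≤ 2 * Fintype.card G ^ m *
      (Finset.univ.filter fun t : G => (fun i => y i - t) ∈ L).card := by
    by_contra! hcon
    have h1 : ∑ y : Fin m → G, (Finset.univ.filter fun t : G => (fun i => y i - t) ∈ L).card
        = Fintype.card G * L.card := by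
      simp only [Finset.card_filter]
      rw [Finset.sum_comm]
      have : ∀ t : G, ∑ y : Fin m → G, (if (fun i => y i - t) ∈ L then 1 else 0) = L.card := by
        intro t
        rw [Finset.card_eq_sum_ones, ← Finset.sum_filter]
        refine Finset.sum_bij' (fun y _ => fun i => y i - t) (fun a _ => fun i => a i + t)
          ?_ ?_ ?_ ?_ ?_ <;> simp
      simp [this]
    have h2 := Finset.sum_lt_sum_of_nonempty (s := (Finset.univ : Finset (Fin m → G)))
      Finset.univ_nonempty (fun y _ => hcon y)
    rw [← Finset.mul_sum, h1] at h2
    simp only [Finset.sum_const, Finset.card_univ, Fintype.card_pi, Finset.prod_const,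
      Fintype.card_fin, smul_eq_mul] at h2
    have h3 : Fintype.card G ^ m * (Fintype.card G * M.card ^ m) ≤
        Fintype.card G ^ m * (Fintype.card G * (2 * L.card)) := by gcongr
    nlinarith
  refine ⟨_, hy, fun t ht t₀ ht₀ => ?_⟩
  have ht := hLbad _ (Finset.mem_filter.1 ht).2
  have ht₀ := hLbad _ (Finset.mem_filter.1 ht₀).2
  have hsub : (Finset.univ.filter fun x =>
      2 * η < |avgOver M f (x + (t - t₀)) - avgOver M f x|) ⊆
      badPoints M f η (fun i => y i - t) ∪
        (badPoints M f η (fun i => y i - t₀)).image (fun z => z - (t - t₀)) := by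
    intro x hx
    by_contra hcon
    rw [Finset.mem_union, not_or] at hcon
    obtain ⟨h1, h2⟩ := hcon
    have h1 : |(∑ i, f (x - (y i - t))) / m - avgOver M f x| ≤ η := by
      simpa [badPoints] using h1
    have h2 : |(∑ i, f (x + (t - t₀) - (y i - t₀))) / m - avgOver M f (x + (t - t₀))| ≤ η := by
      by_contra h3
      refine h2 (Finset.mem_image.2 ⟨x + (t - t₀), ?_, by abel⟩)
      simpa [badPoints] using h3
    have h3 : ∀ i, x + (t - t₀) - (y i - t₀) = x - (y i - t) := fun i => by abel
    simp only [h3] at h2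
    have hx := (Finset.mem_filter.1 hx).2
    rw [abs_le] at h1 h2
    rcases lt_abs.1 hx with h | h <;> linarith [h1.1, h1.2, h2.1, h2.2]
  have hcard := (Finset.card_le_card hsub).trans (Finset.card_union_le _ _)
  have himg := Finset.card_image_le (s := badPoints M f η (fun i => y i - t₀))
    (f := fun z => z - (t - t₀))
  have : ((Finset.univ.filter fun x =>
      2 * η < |avgOver M f (x + (t - t₀)) - avgOver M f x|).card : ℝ) ≤
      (badPoints M f η (fun i => y i - t)).card + (badPoints M f η (fun i => y i - t₀)).card := by
    exact_mod_cast hcard.trans (by omega)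
  linarith

/-- The average of `f (x + b - a)` over the pairs `(a, b) ∈ M₁ × M₂`. -/
def pairAvg [AddCommGroup G] (M₁ M₂ : Finset G) (f : G → ℝ) (x : G) : ℝ :=
  (∑ b ∈ M₂, avgOver M₁ f (x + b)) / M₂.card

lemma avgOver_mem [AddCommGroup G] (M : Finset G) (f : G → ℝ)
    (hf : ∀ x, 0 ≤ f x ∧ f x ≤ 1) (x : G) : 0 ≤ avgOver M f x ∧ avgOver M f x ≤ 1 := by
  refine ⟨div_nonneg (Finset.sum_nonneg fun a _ => (hf _).1) (by positivity), ?_⟩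
  refine div_le_one_of_le₀ ?_ (by positivity)
  calc _ ≤ ∑ a ∈ M, (1 : ℝ) := Finset.sum_le_sum fun a _ => (hf _).2
    _ = _ := by simp

lemma abs_pairAvg_shift_sub_le [Fintype G] [AddCommGroup G] (M₁ M₂ : Finset G)
    (hM₂ : M₂.Nonempty) (f : G → ℝ) (hf : ∀ x, 0 ≤ f x ∧ f x ≤ 1) (η β : ℝ) (hη : 0 ≤ η) (s : G)
    (hs : ((Finset.univ.filter fun x =>
          2 * η < |avgOver M₁ f (x + s) - avgOver M₁ f x|).card : ℝ)
          ≤ 2 * β * Fintype.card G) (hβ : β * Fintype.card G ≤ η * M₂.card) (x : G) :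
    |pairAvg M₁ M₂ f (x + s) - pairAvg M₁ M₂ f x| ≤ 4 * η := by
  have hc : (0 : ℝ) < M₂.card := by exact_mod_cast hM₂.card_pos
  rw [pairAvg, pairAvg, ← sub_div, abs_div, abs_of_pos hc, div_le_iff₀ hc,
    ← Finset.sum_sub_distrib]
  set B := Finset.univ.filter fun x => 2 * η < |avgOver M₁ f (x + s) - avgOver M₁ f x| with hB
  calc _ ≤ ∑ b ∈ M₂, |avgOver M₁ f (x + s + b) - avgOver M₁ f (x + b)| :=
        Finset.abs_sum_le_sum_abs _ _
    _ ≤ ∑ b ∈ M₂, (2 * η + if x + b ∈ B then 1 else 0) := by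
        refine Finset.sum_le_sum fun b _ => ?_
        rw [show x + s + b = x + b + s by abel]
        split_ifs with h
        · have h1 := avgOver_mem M₁ f hf (x + b + s)
          have h2 := avgOver_mem M₁ f hf (x + b)
          rw [abs_le]
          constructor <;> linarith [h1.1, h1.2, h2.1, h2.2]
        · simpa [hB] using h
    _ = 2 * η * M₂.card + ((M₂.filter fun b => x + b ∈ B).card : ℝ) := by
        rw [Finset.sum_add_distrib]
        simp
        ring
    _ ≤ 2 * η * M₂.card + B.card := by
        refine add_le_add le_rfl (Nat.cast_le.2 ?_)
        exact Finset.card_le_card_of_injOn (fun b => x + b)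
          (fun b hb => (Finset.mem_filter.1 hb).2) (fun a _ b _ h => add_left_cancel h)
    _ ≤ _ := by linarith

/-! ### Fourier analysis on `F ^ n` -/

section Fourier

variable {F : Type*} [Field F] {n : ℕ}

/-- The character `x ↦ χ (r ⬝ᵥ x)` of `F ^ n`. -/
def dotChar (χ : AddChar F ℂ) (r x : Fin n → F) : ℂ := χ (r ⬝ᵥ x)

/-- The exponential sum `∑ a ∈ A, χ (r ⬝ᵥ a)`. -/
def expSum (χ : AddChar F ℂ) (A : Finset (Fin n → F)) (r : Fin n → F) : ℂ :=
  ∑ a ∈ A, dotChar χ r a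

lemma dotChar_add (χ : AddChar F ℂ) (r x y : Fin n → F) :
    dotChar χ r (x + y) = dotChar χ r x * dotChar χ r y := by
  simp [dotChar, dotProduct_add, AddChar.map_add_eq_mul]

variable [Fintype F]

lemma dotChar_neg (χ : AddChar F ℂ) (r x : Fin n → F) :
    dotChar χ r (-x) = starRingEnd ℂ (dotChar χ r x) := by
  simp [dotChar, dotProduct_neg, AddChar.map_neg_eq_conj]

lemma dotChar_sub (χ : AddChar F ℂ) (r x y : Fin n → F) :
    dotChar χ r (x - y) = dotChar χ r x * starRingEnd ℂ (dotChar χ r y) := by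
  rw [sub_eq_add_neg, dotChar_add, dotChar_neg]

lemma norm_dotChar (χ : AddChar F ℂ) (r x : Fin n → F) : ‖dotChar χ r x‖ = 1 :=
  AddChar.norm_apply _ _

lemma sum_dotChar (χ : AddChar F ℂ) (hχ : χ.IsPrimitive) (x : Fin n → F) :
    ∑ r, dotChar χ r x = if x = 0 then (Fintype.card (Fin n → F) : ℂ) else 0 := by
  have h1 : ∀ r, dotChar χ r x = ∏ i, χ (r i * x i) := by
    intro r
    rw [dotChar, dotProduct]
    induction (Finset.univ : Finset (Fin n)) using Finset.induction_on with
    | empty => simp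
    | insert i s hi ih => rw [Finset.sum_insert hi, Finset.prod_insert hi,
        AddChar.map_add_eq_mul, ih]
  simp only [h1]
  rw [← Fintype.piFinset_univ, ← Finset.prod_univ_sum (fun _ : Fin n => (Finset.univ : Finset F))
    (fun i a => χ (a * x i))]
  simp only [AddChar.sum_mulShift _ hχ]
  split_ifs with h
  · subst h
    simp
  · obtain ⟨i, hi⟩ := Function.ne_iff.1 h
    refine Finset.prod_eq_zero (Finset.mem_univ i) ?_
    rw [if_neg (by simpa using hi)]
    simp

lemma sum_norm_expSum_sq (χ : AddChar F ℂ) (hχ : χ.IsPrimitive) (A : Finset (Fin n → F)) :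
    ∑ r, ‖expSum χ A r‖ ^ 2 = Fintype.card (Fin n → F) * A.card := by
  have : ∑ r, ((‖expSum χ A r‖ : ℂ)) ^ 2 = Fintype.card (Fin n → F) * A.card := by
    have h1 : ∀ r, ((‖expSum χ A r‖ : ℂ)) ^ 2 = ∑ a ∈ A, ∑ b ∈ A, dotChar χ r (a - b) := by
      intro r
      rw [← Complex.mul_conj', expSum, map_sum, Finset.sum_mul_sum]
      simp only [dotChar_sub]
    simp only [h1]
    rw [Finset.sum_comm]
    have h2 : ∀ a ∈ A, ∑ r, ∑ b ∈ A, dotChar χ r (a - b) = (Fintype.card (Fin n → F) : ℂ) := by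
      intro a ha
      rw [Finset.sum_comm]
      simp only [sum_dotChar χ hχ, sub_eq_zero]
      simp [ha]
    rw [Finset.sum_congr rfl h2]
    simp [mul_comm]
  exact_mod_cast this

lemma fourier_inversion (χ : AddChar F ℂ) (hχ : χ.IsPrimitive) (f : (Fin n → F) → ℝ)
    (x : Fin n → F) :
    (f x : ℂ) = (Fintype.card (Fin n → F) : ℂ)⁻¹ *
      ∑ r, (∑ s, f s * starRingEnd ℂ (dotChar χ r s)) * dotChar χ r x := by
  have hN : (Fintype.card (Fin n → F) : ℂ) ≠ 0 := by exact_mod_cast Fintype.card_ne_zero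
  have h1 : ∑ r, (∑ s, f s * starRingEnd ℂ (dotChar χ r s)) * dotChar χ r x
      = ∑ s, (f s : ℂ) * ∑ r, dotChar χ r (x - s) := by
    simp only [Finset.sum_mul, Finset.mul_sum]
    rw [Finset.sum_comm]
    refine Finset.sum_congr rfl fun s _ => Finset.sum_congr rfl fun r _ => ?_
    rw [dotChar_sub]
    ring
  rw [h1]
  simp only [sum_dotChar χ hχ, sub_eq_zero]
  simp
  field_simp

/-- The Fourier coefficients of `pairAvg M₁ M₂ f`. -/
def pairCoeff (χ : AddChar F ℂ) (M₁ M₂ : Finset (Fin n → F)) (f : (Fin n → F) → ℝ)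
    (r : Fin n → F) : ℂ :=
  (Fintype.card (Fin n → F) : ℂ)⁻¹ * (∑ s, f s * starRingEnd ℂ (dotChar χ r s)) *
    (starRingEnd ℂ (expSum χ M₁ r) / M₁.card) * (expSum χ M₂ r / M₂.card)

lemma pairAvg_eq_sum (χ : AddChar F ℂ) (hχ : χ.IsPrimitive) (M₁ M₂ : Finset (Fin n → F))
    (f : (Fin n → F) → ℝ) (x : Fin n → F) :
    (pairAvg M₁ M₂ f x : ℂ) = ∑ r, pairCoeff χ M₁ M₂ f r * dotChar χ r x := by
  simp only [pairAvg, avgOver, Complex.ofReal_div, Complex.ofReal_sum, Complex.ofReal_natCast]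
  have h : ∀ b a : Fin n → F, (f (x + b - a) : ℂ) = ∑ r, (Fintype.card (Fin n → F) : ℂ)⁻¹ *
      (∑ s, f s * starRingEnd ℂ (dotChar χ r s)) * dotChar χ r x * dotChar χ r b *
        starRingEnd ℂ (dotChar χ r a) := by
    intro b a
    rw [fourier_inversion χ hχ f (x + b - a), Finset.mul_sum]
    refine Finset.sum_congr rfl fun r _ => ?_
    rw [dotChar_sub, dotChar_add]
    ring
  simp only [h]
  simp only [pairCoeff, expSum, map_sum, Finset.sum_div, Finset.mul_sum, Finset.sum_mul]
  have h2 : ∀ b : Fin n → F, ∑ a ∈ M₁, ∑ r, (∑ s, (Fintype.card (Fin n → F) : ℂ)⁻¹ *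
      (f s * starRingEnd ℂ (dotChar χ r s)) * dotChar χ r x * dotChar χ r b *
        starRingEnd ℂ (dotChar χ r a)) / M₁.card / M₂.card =
      ∑ r, ∑ a ∈ M₁, (∑ s, (Fintype.card (Fin n → F) : ℂ)⁻¹ *
      (f s * starRingEnd ℂ (dotChar χ r s)) * dotChar χ r x * dotChar χ r b *
        starRingEnd ℂ (dotChar χ r a)) / M₁.card / M₂.card := fun b => Finset.sum_comm
  simp only [Finset.sum_div] at h2
  rw [Finset.sum_congr rfl fun b _ => h2 b, Finset.sum_comm]
  refine Finset.sum_congr rfl fun r _ => Finset.sum_congr rfl fun b _ => ?_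
  refine Finset.sum_congr rfl fun a _ => Finset.sum_congr rfl fun s _ => ?_
  ring

lemma sum_norm_pairCoeff_le (χ : AddChar F ℂ) (hχ : χ.IsPrimitive) (M₁ M₂ : Finset (Fin n → F))
    (hM₁ : M₁.Nonempty) (hM₂ : M₂.Nonempty)
    (f : (Fin n → F) → ℝ) (hf : ∀ x, 0 ≤ f x ∧ f x ≤ 1) :
    ∑ r, ‖pairCoeff χ M₁ M₂ f r‖ ≤ ((Fintype.card (Fin n → F) : ℝ) / M₁.card +
      (Fintype.card (Fin n → F) : ℝ) / M₂.card) / 2 := by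
  set N : ℝ := (Fintype.card (Fin n → F) : ℝ) with hN
  have hN0 : 0 < N := by rw [hN]; exact_mod_cast Fintype.card_pos
  have h1 : (0 : ℝ) < M₁.card := by exact_mod_cast hM₁.card_pos
  have h2 : (0 : ℝ) < M₂.card := by exact_mod_cast hM₂.card_pos
  have hfh : ∀ r, ‖∑ s, (f s : ℂ) * starRingEnd ℂ (dotChar χ r s)‖ ≤ N := by
    intro r
    refine (norm_sum_le _ _).trans ?_
    calc _ ≤ ∑ s : Fin n → F, (1 : ℝ) := by
          refine Finset.sum_le_sum fun s _ => ?_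
          rw [norm_mul, RCLike.norm_conj, norm_dotChar, mul_one, Complex.norm_real,
            Real.norm_of_nonneg (hf s).1]
          exact (hf s).2
      _ = N := by simp [hN]
  have hr : ∀ r, ‖pairCoeff χ M₁ M₂ f r‖ ≤
      (‖expSum χ M₁ r‖ ^ 2 + ‖expSum χ M₂ r‖ ^ 2) / (2 * (M₁.card * M₂.card)) := by
    intro r
    rw [pairCoeff, norm_mul, norm_mul, norm_mul, norm_inv, norm_div, norm_div, RCLike.norm_conj]
    simp only [Complex.norm_natCast, ← hN]
    calc _ ≤ N⁻¹ * N * (‖expSum χ M₁ r‖ / M₁.card) * (‖expSum χ M₂ r‖ / M₂.card) := by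
          gcongr
          exact hfh r
      _ = (2 * (‖expSum χ M₁ r‖ * ‖expSum χ M₂ r‖)) / (2 * (M₁.card * M₂.card)) := by
          field_simp
      _ ≤ _ := by
          gcongr
          nlinarith [sq_nonneg (‖expSum χ M₁ r‖ - ‖expSum χ M₂ r‖)]
  refine (Finset.sum_le_sum fun r _ => hr r).trans (le_of_eq ?_)
  rw [← Finset.sum_div, Finset.sum_add_distrib, sum_norm_expSum_sq χ hχ, sum_norm_expSum_sq χ hχ]
  field_simp
  ring

/-! ### Iterated averaging over translates -/

/-- The average of `h` over the translates `x + (t - t₀)`, `t ∈ T`. -/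
def shiftAvg [AddCommGroup G] (T : Finset G) (t₀ : G) (h : G → ℂ) (x : G) : ℂ :=
  (∑ t ∈ T, h (x + (t - t₀))) / T.card

lemma norm_iterate_shiftAvg_sub_le [AddCommGroup G] (T : Finset G) (hT : T.Nonempty) (t₀ : G)
    (h : G → ℂ) (δ : ℝ) (hδ : ∀ t ∈ T, ∀ x, ‖h (x + (t - t₀)) - h x‖ ≤ δ) (k : ℕ) (x : G) :
    ‖(shiftAvg T t₀)^[k] h x - h x‖ ≤ k * δ := by
  have hc : (0 : ℝ) < T.card := by exact_mod_cast hT.card_pos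
  have hc' : (T.card : ℂ) ≠ 0 := by exact_mod_cast hc.ne'
  induction k generalizing x with
  | zero => simp
  | succ k ih =>
    rw [Function.iterate_succ_apply']
    have h1 : shiftAvg T t₀ ((shiftAvg T t₀)^[k] h) x - h x =
        (∑ t ∈ T, (((shiftAvg T t₀)^[k] h (x + (t - t₀)) - h (x + (t - t₀))) +
          (h (x + (t - t₀)) - h x))) / T.card := by
      rw [eq_div_iff hc', sub_mul, shiftAvg, div_mul_cancel₀ _ hc']
      simp [mul_comm]
    rw [h1, norm_div, Complex.norm_natCast, div_le_iff₀ hc]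
    refine (norm_sum_le _ _).trans ?_
    calc _ ≤ ∑ t ∈ T, (k * δ + δ) := Finset.sum_le_sum fun t ht =>
          (norm_add_le _ _).trans (add_le_add (ih _) (hδ t ht x))
      _ = _ := by simp; ring

lemma iterate_shiftAvg_sum_dotChar (χ : AddChar F ℂ) (T : Finset (Fin n → F)) (t₀ : Fin n → F)
    (w : (Fin n → F) → ℂ) (k : ℕ) (x : Fin n → F) :
    (shiftAvg T t₀)^[k] (fun x => ∑ r, w r * dotChar χ r x) x =
      ∑ r, w r * (expSum χ T r * starRingEnd ℂ (dotChar χ r t₀) / T.card) ^ k *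
        dotChar χ r x := by
  induction k generalizing x with
  | zero => simp
  | succ k ih =>
    rw [Function.iterate_succ_apply', shiftAvg]
    simp only [ih]
    rw [Finset.sum_comm, Finset.sum_div]
    refine Finset.sum_congr rfl fun r _ => ?_
    simp only [dotChar_add, dotChar_sub]
    rw [← Finset.mul_sum, ← Finset.mul_sum, ← Finset.sum_mul, expSum, pow_succ]
    ring

/-- Translating by an element annihilated by all the large frequencies of `T` has little effect
after averaging many times over `T`. -/
lemma norm_iterate_shiftAvg_translate_le (χ : AddChar F ℂ) (T : Finset (Fin n → F))
    (t₀ : Fin n → F) (w : (Fin n → F) → ℂ) (v : Fin n → F)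
    (hv : ∀ r, (T.card : ℝ) / 2 ≤ ‖expSum χ T r‖ → r ⬝ᵥ v = 0) (k : ℕ) :
    ‖(shiftAvg T t₀)^[k] (fun x => ∑ r, w r * dotChar χ r x) v -
      (shiftAvg T t₀)^[k] (fun x => ∑ r, w r * dotChar χ r x) 0‖
        ≤ 2 * (1 / 2) ^ k * ∑ r, ‖w r‖ := by
  rw [iterate_shiftAvg_sum_dotChar, iterate_shiftAvg_sum_dotChar, ← Finset.sum_sub_distrib,
    Finset.mul_sum]
  refine (norm_sum_le _ _).trans (Finset.sum_le_sum fun r _ => ?_)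
  rw [← mul_sub, norm_mul, norm_mul, norm_pow, norm_div, norm_mul, RCLike.norm_conj, norm_dotChar,
    mul_one, Complex.norm_natCast]
  by_cases h : (T.card : ℝ) / 2 ≤ ‖expSum χ T r‖
  · have : dotChar χ r v - dotChar χ r 0 = 0 := by simp [dotChar, hv r h]
    rw [this, norm_zero, mul_zero]
    positivity
  · push Not at h
    have h1 : ‖dotChar χ r v - dotChar χ r 0‖ ≤ 2 := by
      refine (norm_sub_le _ _).trans ?_
      rw [norm_dotChar, norm_dotChar]
      norm_num
    have h2 : ‖expSum χ T r‖ / T.card ≤ 1 / 2 := by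
      have : (0 : ℝ) < T.card := by
        have := norm_nonneg (expSum χ T r)
        linarith
      rw [div_le_iff₀ this]
      linarith
    calc _ ≤ ‖w r‖ * (1 / 2) ^ k * 2 := by gcongr
      _ = _ := by ring

/-! ### The large spectrum spans a space of small dimension -/

lemma card_mul_sum_comp {H : Type*} [AddCommGroup G] [Fintype G] [AddCommGroup H] [Fintype H]
    (φ : G →+ H) (hφ : Function.Surjective φ) (g : H → ℝ) :
    Fintype.card H * ∑ x, g (φ x) = Fintype.card G * ∑ y, g y := by
  have hfib : ∀ y, (Finset.univ.filter fun x => φ x = y).card =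
      (Finset.univ.filter fun x => φ x = 0).card := fun y =>
    AddMonoidHom.card_fiber_eq_of_mem_range φ (hφ y) (hφ 0)
  have h1 : ∀ g : H → ℝ, ∑ x, g (φ x) =
      (Finset.univ.filter fun x => φ x = 0).card * ∑ y, g y := by
    intro g
    rw [← Finset.sum_fiberwise (s := Finset.univ) (g := φ), Finset.mul_sum]
    refine Finset.sum_congr rfl fun y _ => ?_
    rw [← hfib y, ← nsmul_eq_mul, ← Finset.sum_const]
    exact Finset.sum_congr rfl fun x hx => by rw [(Finset.mem_filter.1 hx).2]
  have h2 := h1 (fun _ => 1)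
  simp only [Finset.sum_const, Finset.card_univ, nsmul_eq_mul, mul_one] at h2
  rw [h1 g, h2]
  ring

lemma card_le_of_linearIndependent_spectrum (χ : AddChar F ℂ) (hχ : χ ≠ 1)
    (T : Finset (Fin n → F)) (hT : T.Nonempty) {ι : Type*} [Fintype ι] (v : ι → Fin n → F)
    (hv : LinearIndependent F v) (hvT : ∀ i, (T.card : ℝ) / 2 ≤ ‖expSum χ T (v i)‖) :
    (Fintype.card ι : ℝ) ≤ 8 * Real.log (Fintype.card (Fin n → F) / T.card) := by
  have hc : (0 : ℝ) < T.card := by exact_mod_cast hT.card_pos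
  have hN : (0 : ℝ) < Fintype.card (Fin n → F) := by exact_mod_cast Fintype.card_pos
  set z : ι → ℂ := fun i => expSum χ T (v i) with hz
  set c : ι → ℂ := fun i => starRingEnd ℂ (z i) / ‖z i‖ with hcdef
  have hcn : ∀ i, ‖c i‖ ≤ 1 := by
    intro i
    rw [hcdef]
    simp only [norm_div, RCLike.norm_conj, Complex.norm_real, norm_norm]
    exact div_self_le_one _
  have hcz : ∀ i, (c i * z i).re = ‖z i‖ := by
    intro i
    have h1 : c i * z i = (‖z i‖ : ℂ) := by
      by_cases h0 : z i = 0
      · simp [h0]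
      · have h0' : (‖z i‖ : ℂ) ≠ 0 := by simpa using h0
        rw [hcdef]
        simp only
        rw [div_mul_eq_mul_div, mul_comm, Complex.mul_conj', sq, mul_div_assoc, div_self h0',
          mul_one]
    rw [h1, Complex.ofReal_re]
  set L : (Fin n → F) →ₗ[F] (ι → F) := Matrix.mulVecLin (Matrix.of v) with hL
  have hLs : Function.Surjective L := by
    rw [← LinearMap.range_eq_top]
    apply Submodule.eq_top_of_finrank_eq
    rw [Module.finrank_fintype_fun_eq_card]
    exact LinearIndependent.rank_matrix (M := Matrix.of v) hv
  have hLv : ∀ x i, L x i = v i ⬝ᵥ x := fun x i => rfl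
  set Y : (Fin n → F) → ℝ := fun x => ∑ i, (c i * χ (L x i)).re with hY
  have hYT : (Fintype.card ι / 2 : ℝ) * T.card ≤ ∑ x ∈ T, Y x := by
    rw [hY, Finset.sum_comm]
    have : ∀ i, ∑ x ∈ T, (c i * χ (L x i)).re = ‖z i‖ := by
      intro i
      rw [← hcz i, ← Complex.re_sum, ← Finset.mul_sum]
      rfl
    simp only [this]
    calc _ = ∑ i : ι, (T.card : ℝ) / 2 := by simp; ring
      _ ≤ _ := Finset.sum_le_sum fun i _ => hvT i
  have hlow : (T.card : ℝ) * Real.exp (1 / 4 * Fintype.card ι) ≤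
      ∑ x, Real.exp (1 / 2 * Y x) := by
    set a : ℝ := 1 / 4 * Fintype.card ι with ha
    calc (T.card : ℝ) * Real.exp a ≤ ∑ x ∈ T, Real.exp a * (1 / 2 * Y x - a + 1) := by
          rw [← Finset.mul_sum, Finset.sum_add_distrib, Finset.sum_sub_distrib, ← Finset.mul_sum,
            mul_comm]
          refine mul_le_mul_of_nonneg_left ?_ (Real.exp_pos _).le
          simp only [Finset.sum_const, nsmul_eq_mul]
          rw [ha]
          linarith
      _ ≤ ∑ x ∈ T, Real.exp (1 / 2 * Y x) := by
          refine Finset.sum_le_sum fun x _ => ?_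
          calc _ ≤ Real.exp a * Real.exp (1 / 2 * Y x - a) := by
                gcongr
                exact Real.add_one_le_exp _
            _ = _ := by rw [← Real.exp_add]; congr 1; ring
      _ ≤ _ := Finset.sum_le_sum_of_subset_of_nonneg (Finset.subset_univ _)
          fun _ _ _ => (Real.exp_pos _).le
  have hup : ∑ x, Real.exp (1 / 2 * Y x) ≤
      Fintype.card (Fin n → F) * Real.exp (1 / 8 * Fintype.card ι) := by
    have hF : (0 : ℝ) < Fintype.card F := by exact_mod_cast Fintype.card_pos
    have h1 := card_mul_sum_comp L.toAddMonoidHom hLs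
      (fun y => Real.exp (1 / 2 * ∑ i, (c i * χ (y i)).re))
    have h2 : ∑ y : ι → F, Real.exp (1 / 2 * ∑ i, (c i * χ (y i)).re) ≤
        (Fintype.card F * Real.exp ((1 / 2) ^ 2 / 2)) ^ Fintype.card ι := by
      have h3 : ∑ y : ι → F, Real.exp (1 / 2 * ∑ i, (c i * χ (y i)).re) =
          ∏ i, ∑ u, Real.exp (1 / 2 * (c i * χ u).re) := by
        rw [Finset.prod_univ_sum, Fintype.piFinset_univ]
        refine Finset.sum_congr rfl fun y _ => ?_
        rw [← Real.exp_sum, Finset.mul_sum]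
      rw [h3, ← Finset.card_univ (α := ι), ← Finset.prod_const]
      refine Finset.prod_le_prod (fun i _ => Finset.sum_nonneg fun _ _ => (Real.exp_pos _).le)
        fun i _ => ?_
      refine sum_exp_mul_le Finset.univ (fun u => (c i * χ u).re) (fun u _ => ?_) ?_ (1 / 2)
      · refine (Complex.abs_re_le_norm _).trans ?_
        rw [norm_mul, AddChar.norm_apply, mul_one]
        exact hcn i
      · rw [← Complex.re_sum, ← Finset.mul_sum, AddChar.sum_eq_zero_of_ne_one hχ]
        simp
    have h4 : (Fintype.card (ι → F) : ℝ) = (Fintype.card F : ℝ) ^ Fintype.card ι := by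
      rw [Fintype.card_fun]
      push_cast
      rfl
    rw [mul_pow, ← Real.exp_nat_mul] at h2
    rw [h4] at h1
    have hq : 0 < (Fintype.card F : ℝ) ^ Fintype.card ι := by positivity
    refine le_of_mul_le_mul_left ?_ hq
    calc _ = _ := h1
      _ ≤ _ := mul_le_mul_of_nonneg_left h2 hN.le
      _ = _ := by
        rw [show (Fintype.card ι : ℝ) * ((1 / 2) ^ 2 / 2) = 1 / 8 * Fintype.card ι by ring]
        ring
  have h5 := hlow.trans hup
  rw [show (1 / 4 * Fintype.card ι : ℝ) = 1 / 8 * Fintype.card ι + 1 / 8 * Fintype.card ι by ring,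
    Real.exp_add, ← mul_assoc] at h5
  have h6 := le_of_mul_le_mul_right h5 (Real.exp_pos _)
  have h7 : Real.exp (1 / 8 * Fintype.card ι) ≤ Fintype.card (Fin n → F) / T.card := by
    rw [le_div_iff₀ hc]
    linarith
  have h8 := (Real.le_log_iff_exp_le (by positivity)).2 h7
  linarith

lemma exists_annihilator_of_spectrum (χ : AddChar F ℂ) (hχ : χ ≠ 1)
    (T : Finset (Fin n → F)) (hT : T.Nonempty) :
    ∃ V : Submodule F (Fin n → F),
      (n : ℝ) - Module.finrank F V ≤ 8 * Real.log (Fintype.card (Fin n → F) / T.card) ∧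
      ∀ v ∈ V, ∀ r, (T.card : ℝ) / 2 ≤ ‖expSum χ T r‖ → r ⬝ᵥ v = 0 := by
  obtain ⟨b, hbS, hbspan, hbli⟩ := exists_linearIndependent F
    {r : Fin n → F | (T.card : ℝ) / 2 ≤ ‖expSum χ T r‖}
  have hcard := card_le_of_linearIndependent_spectrum χ hχ T hT (fun i : b => (i : Fin n → F))
    hbli (fun i => hbS i.2)
  set L : (Fin n → F) →ₗ[F] (b → F) :=
    Matrix.mulVecLin (Matrix.of fun i : b => (i : Fin n → F)) with hL
  refine ⟨LinearMap.ker L, ?_, fun v hv r hr => ?_⟩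
  · have h1 := LinearMap.finrank_range_add_finrank_ker L
    have h2 := Submodule.finrank_le (LinearMap.range L)
    rw [Module.finrank_fintype_fun_eq_card] at h1 h2
    rw [Fintype.card_fin] at h1
    have h3 : (n : ℝ) ≤ Fintype.card b + Module.finrank F (LinearMap.ker L) := by
      exact_mod_cast (by omega : n ≤ Fintype.card b + Module.finrank F (LinearMap.ker L))
    linarith
  · have hr' : r ∈ Submodule.span F b := by
      rw [hbspan]
      exact Submodule.subset_span hr
    refine Submodule.span_induction (p := fun r _ => r ⬝ᵥ v = 0)
      (fun x hx => congrFun (LinearMap.mem_ker.1 hv) ⟨x, hx⟩) (zero_dotProduct v)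
      (fun x y _ _ hx hy => ?_) (fun a x _ hx => ?_) hr'
    · rw [add_dotProduct, hx, hy, add_zero]
    · rw [smul_dotProduct, hx, smul_zero]

/-- A subspace of small codimension all of whose elements are almost periods of
`pairAvg M₁ M₂ f` at the origin. -/
lemma exists_subspace_pairAvg_close (M₁ M₂ : Finset (Fin n → F)) (d : ℝ)
    (hM₁ : (2 : ℝ) ^ (-d) * Fintype.card (Fin n → F) ≤ M₁.card)
    (hM₂ : (2 : ℝ) ^ (-d) * Fintype.card (Fin n → F) ≤ M₂.card)
    (f : (Fin n → F) → ℝ) (hf : ∀ x, 0 ≤ f x ∧ f x ≤ 1)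
    (m k : ℕ) (hm : 0 < m) (η : ℝ) (hη : 0 < η)
    (hmη : 4 * Real.exp (-(η ^ 2 / 2 * m)) ≤ (2 : ℝ) ^ (-d) * η) (hd : 0 ≤ d) :
    ∃ V : Submodule F (Fin n → F),
      (n : ℝ) - Module.finrank F V ≤ 8 * (d * m + 1) ∧
      ∀ v ∈ V, |pairAvg M₁ M₂ f v - pairAvg M₁ M₂ f 0| ≤
        2 * (k * (4 * η)) + 2 * (1 / 2) ^ k * (2 : ℝ) ^ d := by
  set χ : AddChar F ℂ := AddChar.FiniteField.primitiveChar_to_Complex F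
  have hχ : χ.IsPrimitive := AddChar.FiniteField.primitiveChar_to_Complex_isPrimitive F
  have hχ1 : χ ≠ 1 := by
    have := hχ one_ne_zero
    rwa [AddChar.mulShift_one] at this
  have h2d : (0 : ℝ) < 2 ^ (-d) := by positivity
  have h2dd : (2 : ℝ) ^ (-d) * 2 ^ d = 1 := by
    rw [← Real.rpow_add two_pos]
    simp
  have hN : (0 : ℝ) < Fintype.card (Fin n → F) := by exact_mod_cast Fintype.card_pos
  have hc₁ : (0 : ℝ) < M₁.card := lt_of_lt_of_le (by positivity) hM₁
  have hc₂ : (0 : ℝ) < M₂.card := lt_of_lt_of_le (by positivity) hM₂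
  have hne₁ : M₁.Nonempty := Finset.card_pos.1 (by exact_mod_cast hc₁)
  have hne₂ : M₂.Nonempty := Finset.card_pos.1 (by exact_mod_cast hc₂)
  obtain ⟨T, hTcard, hTper⟩ := exists_almost_periods_s15 M₁ hne₁ f hf m hm η ((2 : ℝ) ^ (-d) * η) hη
    (by positivity) hmη
  have hTcard' : (Fintype.card (Fin n → F) : ℝ) * (M₁.card : ℝ) ^ m ≤
      2 * (Fintype.card (Fin n → F) : ℝ) ^ m * T.card := by exact_mod_cast hTcard
  have hTpos : (0 : ℝ) < T.card := by
    by_contra h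
    have h0 : (T.card : ℝ) = 0 := le_antisymm (not_lt.1 h) (Nat.cast_nonneg _)
    rw [h0, mul_zero] at hTcard'
    have : 0 < (Fintype.card (Fin n → F) : ℝ) * (M₁.card : ℝ) ^ m := by positivity
    linarith
  have hTne : T.Nonempty := Finset.card_pos.1 (by exact_mod_cast hTpos)
  have hlog2 : Real.log 2 ≤ 1 := by linarith [Real.log_two_lt_d9]
  have hlog : Real.log (Fintype.card (Fin n → F) / T.card) ≤ d * m + 1 := by
    have h1 : (Fintype.card (Fin n → F) : ℝ) / T.card ≤ 2 * ((2 : ℝ) ^ d) ^ m := by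
      rw [div_le_iff₀ hTpos]
      have h2 : (Fintype.card (Fin n → F) : ℝ) ≤ 2 ^ d * M₁.card := by
        calc (Fintype.card (Fin n → F) : ℝ)
            = 2 ^ d * (2 ^ (-d) * Fintype.card (Fin n → F)) := by
              rw [← mul_assoc, mul_comm ((2 : ℝ) ^ d), h2dd, one_mul]
          _ ≤ _ := by gcongr
      have h3 : (Fintype.card (Fin n → F) : ℝ) ^ m ≤ ((2 : ℝ) ^ d) ^ m * (M₁.card : ℝ) ^ m := by
        rw [← mul_pow]
        gcongr
      have hp : 0 < (M₁.card : ℝ) ^ m := by positivity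
      refine le_of_mul_le_mul_right ?_ hp
      calc _ ≤ _ := hTcard'
        _ ≤ 2 * (((2 : ℝ) ^ d) ^ m * (M₁.card : ℝ) ^ m) * T.card := by gcongr
        _ = _ := by ring
    refine (Real.log_le_log (by positivity) h1).trans ?_
    rw [Real.log_mul (by norm_num) (by positivity), Real.log_pow, Real.log_rpow two_pos]
    have : (m : ℝ) * (d * Real.log 2) ≤ m * (d * 1) := by gcongr
    linarith
  obtain ⟨V, hVdim, hV⟩ := exists_annihilator_of_spectrum χ hχ1 T hTne
  refine ⟨V, hVdim.trans (by linarith), fun v hv => ?_⟩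
  obtain ⟨t₀, ht₀⟩ := hTne
  set Q : (Fin n → F) → ℂ := fun x => (pairAvg M₁ M₂ f x : ℂ) with hQ
  have hQsum : Q = fun x => ∑ r, pairCoeff χ M₁ M₂ f r * dotChar χ r x :=
    funext fun x => pairAvg_eq_sum χ hχ M₁ M₂ f x
  have hnear : ∀ x, ‖(shiftAvg T t₀)^[k] Q x - Q x‖ ≤ k * (4 * η) := by
    refine norm_iterate_shiftAvg_sub_le T ⟨t₀, ht₀⟩ t₀ Q (4 * η) (fun t ht x => ?_) k
    rw [hQ]
    simp only
    rw [← Complex.ofReal_sub, Complex.norm_real, Real.norm_eq_abs]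
    refine abs_pairAvg_shift_sub_le M₁ M₂ hne₂ f hf η ((2 : ℝ) ^ (-d) * η) hη.le (t - t₀)
      (hTper t ht t₀ ht₀) ?_ x
    calc _ = η * ((2 : ℝ) ^ (-d) * Fintype.card (Fin n → F)) := by ring
      _ ≤ _ := by gcongr
  have htrans : ‖(shiftAvg T t₀)^[k] Q v - (shiftAvg T t₀)^[k] Q 0‖ ≤
      2 * (1 / 2) ^ k * (2 : ℝ) ^ d := by
    rw [hQsum]
    refine (norm_iterate_shiftAvg_translate_le χ T t₀ _ v (hV v hv) k).trans ?_
    gcongr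
    refine (sum_norm_pairCoeff_le χ hχ M₁ M₂ hne₁ hne₂ f hf).trans ?_
    have hdiv : ∀ M : Finset (Fin n → F), (0 : ℝ) < M.card →
        (2 : ℝ) ^ (-d) * Fintype.card (Fin n → F) ≤ M.card →
        (Fintype.card (Fin n → F) : ℝ) / M.card ≤ 2 ^ d := by
      intro M hc hM
      rw [div_le_iff₀ hc]
      calc (Fintype.card (Fin n → F) : ℝ)
          = 2 ^ d * (2 ^ (-d) * Fintype.card (Fin n → F)) := by
            rw [← mul_assoc, mul_comm ((2 : ℝ) ^ d), h2dd, one_mul]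
        _ ≤ _ := by gcongr
    linarith [hdiv M₁ hc₁ hM₁, hdiv M₂ hc₂ hM₂]
  have hfin : |pairAvg M₁ M₂ f v - pairAvg M₁ M₂ f 0| = ‖Q v - Q 0‖ := by
    rw [hQ]
    simp only
    rw [← Complex.ofReal_sub, Complex.norm_real, Real.norm_eq_abs]
  rw [hfin]
  have h1 := hnear v
  have h2 := hnear 0
  rw [norm_sub_rev] at h1
  calc ‖Q v - Q 0‖ = ‖(Q v - (shiftAvg T t₀)^[k] Q v) +
        ((shiftAvg T t₀)^[k] Q v - (shiftAvg T t₀)^[k] Q 0) +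
        ((shiftAvg T t₀)^[k] Q 0 - Q 0)‖ := by congr 1; ring
    _ ≤ _ := norm_add₃_le
    _ ≤ _ := by linarith

end Fourier

/-! ### Choice of parameters -/

lemma exists_parameters (ε : ℝ) (hε0 : 0 < ε) (hε1 : ε < 1) :
    ∃ C : ℝ, 0 < C ∧ ∀ d : ℝ, 0 ≤ d → ∃ (m k : ℕ) (η : ℝ), 0 < m ∧ 0 < η ∧
      4 * Real.exp (-(η ^ 2 / 2 * m)) ≤ (2 : ℝ) ^ (-d) * η ∧
      2 * (k * (4 * η)) + 2 * (1 / 2) ^ k * (2 : ℝ) ^ d ≤ ε / 2 ∧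
      8 * (d * m + 1) ≤ C * (d + 1) ^ 4 := by
  obtain ⟨K, hK⟩ := pow_unbounded_of_one_lt (12 / ε) (one_lt_two : (1 : ℝ) < 2)
  set B : ℝ := 24 * (K + 1) / ε with hB
  have hB0 : 0 < B := by positivity
  refine ⟨8 * (2 * B ^ 2 * (2 + B) + 2), by positivity, fun d hd => ?_⟩
  have hK1 : 1 ≤ K := by
    rcases Nat.eq_zero_or_pos K with h | h
    · rw [h, pow_zero, div_lt_one hε0] at hK
      linarith
    · exact h
  set k : ℕ := ⌈d⌉₊ + K with hk
  have hk0 : (0 : ℝ) < k := by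
    have : 0 < k := by omega
    exact_mod_cast this
  have hkd : (k : ℝ) ≤ (K + 1) * (d + 1) := by
    have h1 := (Nat.ceil_lt_add_one hd).le
    have h2 : (0 : ℝ) ≤ K * d := by positivity
    rw [hk]
    push_cast
    linarith
  set η : ℝ := ε / (24 * k) with hη
  have hη0 : 0 < η := by positivity
  have hηinv : 1 / η ≤ B * (d + 1) := by
    have : 1 / η = 24 * k / ε := by rw [hη]; field_simp
    rw [this, hB, div_mul_eq_mul_div]
    gcongr ?_ / _
    linarith
  set m : ℕ := ⌈2 * (1 / η) ^ 2 * (2 + d + 1 / η)⌉₊ with hm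
  have hmpos : 0 < 2 * (1 / η) ^ 2 * (2 + d + 1 / η) := by positivity
  refine ⟨m, k, η, Nat.ceil_pos.2 hmpos, hη0, ?_, ?_, ?_⟩
  · have h1 : 2 + d + 1 / η ≤ η ^ 2 / 2 * m := by
      calc 2 + d + 1 / η = η ^ 2 / 2 * (2 * (1 / η) ^ 2 * (2 + d + 1 / η)) := by field_simp
        _ ≤ _ := by gcongr; exact Nat.le_ceil _
    have h2 : Real.exp (-(η ^ 2 / 2 * m)) ≤
        Real.exp (-2) * Real.exp (-d) * Real.exp (-(1 / η)) := by
      rw [← Real.exp_add, ← Real.exp_add]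
      exact Real.exp_le_exp.2 (by linarith)
    have h3 : 4 * Real.exp (-2) ≤ 1 := by
      have h4 : (2 : ℝ) ≤ Real.exp 1 := by linarith [Real.add_one_le_exp (1 : ℝ)]
      have h5 : Real.exp 2 = Real.exp 1 * Real.exp 1 := by rw [← Real.exp_add]; norm_num
      rw [Real.exp_neg, ← div_eq_mul_inv, div_le_one (Real.exp_pos _), h5]
      nlinarith
    have h6 : Real.exp (-d) ≤ (2 : ℝ) ^ (-d) := by
      rw [Real.rpow_def_of_pos two_pos]
      have : Real.log 2 ≤ 1 := by linarith [Real.log_two_lt_d9]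
      exact Real.exp_le_exp.2 (by nlinarith)
    have h7 : Real.exp (-(1 / η)) ≤ η := by
      have h8 : 1 / η ≤ Real.exp (1 / η) := by linarith [Real.add_one_le_exp (1 / η)]
      rw [Real.exp_neg]
      calc _ ≤ (1 / η)⁻¹ := inv_anti₀ (by positivity) h8
        _ = η := by simp
    calc _ ≤ 4 * (Real.exp (-2) * Real.exp (-d) * Real.exp (-(1 / η))) := by gcongr
      _ = (4 * Real.exp (-2)) * (Real.exp (-d) * Real.exp (-(1 / η))) := by ring
      _ ≤ 1 * ((2 : ℝ) ^ (-d) * η) := by gcongr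
      _ = _ := one_mul _
  · have h1 : (k : ℝ) * (4 * η) = ε / 6 := by rw [hη]; field_simp; norm_num
    have h2 : (1 / 2 : ℝ) ^ k * (2 : ℝ) ^ d ≤ ε / 12 := by
      have h3 : (2 : ℝ) ^ d ≤ 2 ^ ⌈d⌉₊ := by
        rw [← Real.rpow_natCast]
        exact Real.rpow_le_rpow_of_exponent_le one_le_two (Nat.le_ceil d)
      calc _ ≤ (1 / 2 : ℝ) ^ k * 2 ^ ⌈d⌉₊ := by gcongr
        _ = 1 / 2 ^ K := by
          rw [hk, pow_add, one_div_pow, one_div_pow]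
          field_simp
        _ ≤ 1 / (12 / ε) := by gcongr
        _ = _ := by field_simp
    linarith
  · have hd1 : 1 ≤ d + 1 := by linarith
    have h1 : (m : ℝ) ≤ 2 * (B * (d + 1)) ^ 2 * (2 * (d + 1) + B * (d + 1)) + 1 := by
      refine (Nat.ceil_lt_add_one hmpos.le).le.trans ?_
      gcongr
      linarith
    have h2 : (m : ℝ) ≤ (2 * B ^ 2 * (2 + B) + 1) * (d + 1) ^ 3 := by
      have : 1 ≤ (d + 1) ^ 3 := one_le_pow₀ hd1
      calc _ ≤ _ := h1
        _ = 2 * B ^ 2 * (2 + B) * (d + 1) ^ 3 + 1 := by ring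
        _ ≤ _ := by linarith
    have h3 : 1 ≤ (d + 1) ^ 4 := one_le_pow₀ hd1
    have h4 : d * m ≤ (d + 1) * ((2 * B ^ 2 * (2 + B) + 1) * (d + 1) ^ 3) := by
      gcongr
      linarith
    calc _ ≤ 8 * ((d + 1) * ((2 * B ^ 2 * (2 + B) + 1) * (d + 1) ^ 3) + (d + 1) ^ 4) := by
          gcongr
      _ = _ := by ring

/-! ### Reformulation of the inner products -/

lemma expect_muSet_mul [Fintype G] [Nonempty G] (M : Set G) (g : G → ℝ) :
    expect (fun y => muSet M y * g y) = (∑ a ∈ M.toFinset, g a) / M.toFinset.card := by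
  have hN : (Fintype.card G : ℝ) ≠ 0 := by exact_mod_cast Fintype.card_ne_zero
  have h1 : ∑ y, muSet M y * g y =
      (Fintype.card G / M.toFinset.card) * ∑ a ∈ M.toFinset, g a := by
    rw [Finset.mul_sum, ← Finset.sum_subset (Finset.subset_univ M.toFinset)]
    · refine Finset.sum_congr rfl fun y hy => ?_
      have : y ∈ M := by simpa using hy
      simp [muSet, ind, this, Nat.card_eq_fintype_card]
    · intro y _ hy
      have : y ∉ M := by simpa using hy
      simp [muSet, ind, this]
  rw [expect, h1]
  field_simp

lemma expect_dconv_sub_mul [Fintype G] [AddCommGroup G] (M₁ M₂ : Set G) (f : G → ℝ) (v : G) :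
    expect (fun x => dconv (muSet M₁) (muSet M₂) (x - v) * f x) =
      pairAvg M₁.toFinset M₂.toFinset f v := by
  have h1 : ∀ x, dconv (muSet M₁) (muSet M₂) x =
      (∑ a ∈ M₁.toFinset, muSet M₂ (x + a)) / M₁.toFinset.card := fun x =>
    expect_muSet_mul M₁ _
  have h2 : ∀ a, (∑ x, muSet M₂ (x - v + a) * f x) / Fintype.card G =
      (∑ b ∈ M₂.toFinset, f (v + b - a)) / M₂.toFinset.card := by
    intro a
    rw [← expect_muSet_mul M₂ (fun b => f (v + b - a)), expect]
    congr 1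
    refine Fintype.sum_equiv (Equiv.addRight (a - v)) _ _ fun x => ?_
    simp only [Equiv.coe_addRight]
    congr 2 <;> abel_nf
  simp only [h1, expect, pairAvg, avgOver]
  calc _ = (∑ a ∈ M₁.toFinset, (∑ x, muSet M₂ (x - v + a) * f x) / Fintype.card G) /
        M₁.toFinset.card := by
        simp only [Finset.sum_div, Finset.sum_mul]
        rw [Finset.sum_comm]
        refine Finset.sum_congr rfl fun a _ => Finset.sum_congr rfl fun x _ => ?_
        ring
    _ = _ := by
        simp only [h2, Finset.sum_div]
        rw [Finset.sum_comm]
        refine Finset.sum_congr rfl fun b _ => Finset.sum_congr rfl fun a _ => ?_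
        ring

lemma inprod_dconv_ind [Fintype G] [AddCommGroup G] (M₁ M₂ S : Set G) :
    inprod (dconv (muSet M₁) (muSet M₂)) (ind S) =
      pairAvg M₁.toFinset M₂.toFinset (ind S) 0 := by
  rw [← expect_dconv_sub_mul, inprod]
  simp

lemma inprod_conv_dconv_ind [Fintype G] [AddCommGroup G] (V M₁ M₂ S : Set G) :
    inprod (conv (muSet V) (dconv (muSet M₁) (muSet M₂))) (ind S) =
      (∑ v ∈ V.toFinset, pairAvg M₁.toFinset M₂.toFinset (ind S) v) / V.toFinset.card := by
  have h1 : ∀ x, conv (muSet V) (dconv (muSet M₁) (muSet M₂)) x =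
      (∑ v ∈ V.toFinset, dconv (muSet M₁) (muSet M₂) (x - v)) / V.toFinset.card := fun x =>
    expect_muSet_mul V _
  simp only [inprod, h1, ← expect_dconv_sub_mul, expect, Finset.sum_div, Finset.sum_mul]
  rw [Finset.sum_comm]
  refine Finset.sum_congr rfl fun a _ => Finset.sum_congr rfl fun x _ => ?_
  ring

lemma ind_mem_unitInterval (S : Set G) (x : G) : 0 ≤ ind S x ∧ ind S x ≤ 1 := by
  by_cases h : x ∈ S <;> simp [ind, h]

theorem statement15 (ε : ℝ) (hε0 : 0 < ε) (hε1 : ε < 1) :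
    ∃ C : ℝ, 0 < C ∧ ∀ (F : Type) [Field F] [Fintype F], ∀ n : ℕ, 1 ≤ n →
      ∀ d : ℝ, 0 ≤ d → ∀ M₁ M₂ S : Set (Fin n → F),
        (2 : ℝ) ^ (-d) ≤ (Nat.card M₁ : ℝ) / (Fintype.card F : ℝ) ^ n →
        (2 : ℝ) ^ (-d) ≤ (Nat.card M₂ : ℝ) / (Fintype.card F : ℝ) ^ n →
        1 - ε / 2 ≤ inprod (dconv (muSet M₁) (muSet M₂)) (ind S) →
        ∃ V : Submodule F (Fin n → F),
          (n : ℝ) - (Module.finrank F V : ℝ) ≤ C * (d + 1) ^ 4 ∧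
          1 - ε ≤ inprod (conv (muSet (V : Set (Fin n → F)))
            (dconv (muSet M₁) (muSet M₂))) (ind S) := by
  obtain ⟨C, hC, hpar⟩ := exists_parameters ε hε0 hε1
  refine ⟨C, hC, fun F _ _ n _ d hd M₁ M₂ S hM₁ hM₂ hS => ?_⟩
  obtain ⟨m, k, η, hm, hη, hmη, herr, hdim⟩ := hpar d hd
  have hcard : ∀ M : Set (Fin n → F),
      (2 : ℝ) ^ (-d) ≤ (Nat.card M : ℝ) / (Fintype.card F : ℝ) ^ n →
      (2 : ℝ) ^ (-d) * Fintype.card (Fin n → F) ≤ M.toFinset.card := by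
    intro M hM
    have hq : (0 : ℝ) < (Fintype.card F : ℝ) ^ n :=
      pow_pos (by exact_mod_cast Fintype.card_pos) n
    rw [le_div_iff₀ hq, Nat.card_eq_fintype_card] at hM
    rw [Fintype.card_fun, Fintype.card_fin, Nat.cast_pow, Set.toFinset_card]
    exact hM
  obtain ⟨V, hVdim, hV⟩ := exists_subspace_pairAvg_close M₁.toFinset M₂.toFinset d
    (hcard M₁ hM₁) (hcard M₂ hM₂) (ind S) (ind_mem_unitInterval S) m k hm η hη hmη hd
  refine ⟨V, hVdim.trans hdim, ?_⟩
  rw [inprod_dconv_ind] at hS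
  have hVpos : (0 : ℝ) < (V : Set (Fin n → F)).toFinset.card := by
    exact_mod_cast Finset.card_pos.2 ⟨0, by simp⟩
  rw [inprod_conv_dconv_ind, le_div_iff₀ hVpos, mul_comm, ← nsmul_eq_mul]
  refine Finset.card_nsmul_le_sum _ _ _ fun v hv => ?_
  have h := (abs_le.1 ((hV v (by simpa using hv)).trans herr)).1
  linarith

end SkewPaper
end
end
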